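/- arXiv:1604.06664 — 4 statements merged into one kernel-verified Lean document; each statement's English description precedes it below -/
import Mathlib

section
/- Assume H1. For each d let X^d have density π^d(x) = ∏_{i=1}^d π(x_i) and Z^d be an independent standard d-dimensional Gaussian vector; set ΔV_i^d = V(X_i^d) − V(X_i^d + ℓ d^{−1/2} Z_i^d), b^d(x,z) = −(ℓ z/√d) V̇(x) + 2 E[ζ^d(X_1^d,Z_1^d)] − (ℓ²/(4d)) V̇(x)², and υ^d = −ℓ d^{−1/2} Z_1^d V̇(X_1^d) + ∑_{i=2}^d b^d(X_i^d, Z_i^d). Then for every q ≥ 0, lim_{d→∞} E[ (Z_1^d)^q · |min(1, exp(∑_{i=1}^d ΔV_i^d)) − min(1, exp(υ^d))| ] = 0. -/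
open MeasureTheory ProbabilityTheory Filter Real
open scoped ENNReal NNReal Topology

noncomputable section

/-- The normalized target density `π(x) = exp(-V(x)) / ∫ exp(-V(y)) dy`. -/
def piDen (V : ℝ → ℝ) (x : ℝ) : ℝ := Real.exp (-V x) / ∫ y : ℝ, Real.exp (-V y)

/-- The probability measure on `ℝ` with density `π`. -/
def piMeasure (V : ℝ → ℝ) : Measure ℝ :=
  MeasureTheory.volume.withDensity (fun x => ENNReal.ofReal (piDen V x))

/-- `ζ^d(x,z) = exp((V(x) - V(x + ℓ d^{-1/2} z))/2) - 1`. -/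
def zeta (V : ℝ → ℝ) (ℓ : ℝ) (d : ℕ) (x z : ℝ) : ℝ :=
  Real.exp ((V x - V (x + ℓ * z / Real.sqrt d)) / 2) - 1

/-- The standard normal cumulative distribution function `Φ`. -/
def stdGaussCDF (s : ℝ) : ℝ := (gaussianReal 0 1 (Set.Iic s)).toReal

/-- `ΔV_i^d`-type increment: `V(x) - V(x + ℓ z/√d)`. -/
def dV (V : ℝ → ℝ) (ℓ : ℝ) (d : ℕ) (x z : ℝ) : ℝ := V x - V (x + ℓ * z / Real.sqrt d)

/-- `b^d(x,z) = -(ℓ z/√d) V̇(x) + 2 E[ζ^d(X₁,Z₁)] - (ℓ²/(4d)) V̇(x)²`. -/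
def bFun (V Vdot : ℝ → ℝ) (ℓ : ℝ) (d : ℕ) (x z : ℝ) : ℝ :=
  -(ℓ * z / Real.sqrt d) * Vdot x
    + 2 * (∫ q : ℝ × ℝ, zeta V ℓ d q.1 q.2 ∂((piMeasure V).prod (gaussianReal 0 1)))
    - ℓ ^ 2 / (4 * (d : ℝ)) * (Vdot x) ^ 2

/-- Joint law of `(X^d, Z^d)`: `X^d ∼ π^{⊗d}` independent of `Z^d ∼ N(0, I_d)`. -/
def prodPi (V : ℝ → ℝ) (d : ℕ) : Measure ((Fin d → ℝ) × (Fin d → ℝ)) :=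
  (Measure.pi fun _ : Fin d => piMeasure V).prod
    (Measure.pi fun _ : Fin d => gaussianReal 0 1)

lemma aux_exp0 (u : ℝ) : (Real.exp u - 1) ^ 2 ≤ u ^ 2 * (1 + Real.exp (2 * u)) := by
  have h1 := Real.add_one_le_exp u
  have h2 := Real.add_one_le_exp (-u)
  have h3 : Real.exp (-u) * Real.exp u = 1 := by rw [← Real.exp_add]; simp
  have h4 : Real.exp (2 * u) = Real.exp u ^ 2 := by rw [← Real.exp_nat_mul]; simp
  have h5 := Real.exp_pos u
  have h6 : Real.exp u - 1 ≤ u * Real.exp u := by nlinarith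
  rw [h4]
  rcases le_total 0 u with hu | hu
  · have : (Real.exp u - 1) ^ 2 ≤ (u * Real.exp u) ^ 2 :=
      pow_le_pow_left₀ (by linarith) h6 2
    nlinarith [sq_nonneg u]
  · have h7 : Real.exp u ≤ 1 := Real.exp_le_one_iff.mpr hu
    have : (1 - Real.exp u) ^ 2 ≤ (-u) ^ 2 :=
      pow_le_pow_left₀ (by linarith) (by linarith) 2
    nlinarith [sq_nonneg (u * Real.exp u)]

lemma aux_exp1 (u : ℝ) : (Real.exp u - 1 - u) ^ 2 ≤ u ^ 4 * (1 + Real.exp (2 * u)) := by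
  have h0 := aux_exp0 u
  have h1 := Real.add_one_le_exp u
  have h2 := Real.add_one_le_exp (-u)
  have h3 : Real.exp (-u) * Real.exp u = 1 := by rw [← Real.exp_add]; simp
  have h5 := Real.exp_pos u
  have h6 : Real.exp u - 1 ≤ u * Real.exp u := by nlinarith
  have : (Real.exp u - 1 - u) ^ 2 ≤ (u * (Real.exp u - 1)) ^ 2 :=
    pow_le_pow_left₀ (by linarith) (by linarith) 2
  nlinarith [mul_le_mul_of_nonneg_left h0 (sq_nonneg u)]

lemma aux_exp2 (u : ℝ) : |2 * u - 2 * (Real.exp u - 1) + (Real.exp u - 1) ^ 2|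
    ≤ 4 * |u| ^ 3 * (1 + Real.exp (2 * u)) := by
  have hd : ∀ t ∈ Set.uIcc 0 u, HasDerivWithinAt
      (fun t : ℝ => 2 * t - 2 * (Real.exp t - 1) + (Real.exp t - 1) ^ 2)
      (2 * (Real.exp t - 1) ^ 2) (Set.uIcc 0 u) t := by
    intro t _
    apply HasDerivAt.hasDerivWithinAt
    have h1 := (Real.hasDerivAt_exp t).sub_const 1
    have := (((hasDerivAt_id t).const_mul 2).sub (h1.const_mul 2)).add (h1.pow 2)
    refine HasDerivAt.congr_deriv (f' := _) (this.congr_of_eventuallyEq ?_) ?_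
    · exact Filter.Eventually.of_forall fun y => by simp
    · simp; ring
  have hb : ∀ t ∈ Set.uIcc 0 u, ‖2 * (Real.exp t - 1) ^ 2‖ ≤
      4 * |u| ^ 2 * (1 + Real.exp (2 * u)) := by
    intro t ht
    have h1 : |t| ≤ |u| := by simpa using Set.abs_sub_left_of_mem_uIcc ht
    have h2 : Real.exp (2 * t) ≤ 1 + Real.exp (2 * u) := by
      rcases le_total 0 u with hu | hu
      · rw [Set.uIcc_of_le hu] at ht
        have : Real.exp (2 * t) ≤ Real.exp (2 * u) := Real.exp_le_exp.mpr (by linarith [ht.2])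
        linarith
      · rw [Set.uIcc_of_ge hu] at ht
        have : Real.exp (2 * t) ≤ 1 := Real.exp_le_one_iff.mpr (by linarith [ht.2])
        linarith [Real.exp_pos (2 * u)]
    rw [Real.norm_of_nonneg (by positivity)]
    have h3 := aux_exp0 t
    have h4 : t ^ 2 ≤ |u| ^ 2 := by rw [← sq_abs t]; exact pow_le_pow_left₀ (abs_nonneg _) h1 2
    have h5 : t ^ 2 * (1 + Real.exp (2 * t)) ≤ |u| ^ 2 * (2 * (1 + Real.exp (2 * u))) := by
      apply mul_le_mul h4 _ (by positivity) (by positivity)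
      linarith [Real.exp_pos (2 * u)]
    linarith
  have := (convex_uIcc (0:ℝ) u).norm_image_sub_le_of_norm_hasDerivWithin_le hd hb
    Set.left_mem_uIcc Set.right_mem_uIcc
  simp only [Real.norm_eq_abs] at this
  simp at this
  refine this.trans (le_of_eq ?_)
  rw [← sq_abs u]; ring

lemma lyap {Ω : Type*} [MeasurableSpace Ω] (μ : Measure Ω) [IsProbabilityMeasure μ]
    (f : Ω → ℝ) (hf : Measurable f) (p B : ℝ) (k : ℕ) (hk : 1 ≤ k) (hkp : (k:ℝ) ≤ p)
    (hi : Integrable (fun x => |f x| ^ p) μ)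
    (hB : (∫ x, |f x| ^ p ∂μ) ^ (1 / p) ≤ B) :
    ∫⁻ x, ENNReal.ofReal (|f x| ^ k) ∂μ ≤ ENNReal.ofReal (B ^ k) := by
  have hk1 : (1:ℝ) ≤ k := by exact_mod_cast hk
  have hp0 : 0 < p := by linarith
  have hpne : ENNReal.ofReal p ≠ 0 := by simpa using hp0
  have hm : MemLp f (ENNReal.ofReal p) μ := by
    rw [← integrable_norm_rpow_iff hf.aestronglyMeasurable hpne ENNReal.ofReal_ne_top]
    simpa [ENNReal.toReal_ofReal hp0.le] using hi
  have h1 : eLpNorm f (ENNReal.ofReal p) μ ≤ ENNReal.ofReal B := by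
    rw [hm.eLpNorm_eq_integral_rpow_norm hpne ENNReal.ofReal_ne_top]
    apply ENNReal.ofReal_le_ofReal
    simpa [ENNReal.toReal_ofReal hp0.le] using hB
  have hB0 : 0 ≤ B := le_trans (by positivity) hB
  have h2 : eLpNorm f ((k:NNReal):ENNReal) μ ≤ ENNReal.ofReal B := by
    refine le_trans (eLpNorm_le_eLpNorm_of_exponent_le ?_ hf.aestronglyMeasurable) h1
    rw [← ENNReal.ofReal_coe_nnreal]
    exact ENNReal.ofReal_le_ofReal (by simpa using hkp)
  have h3 := eLpNorm_nnreal_pow_eq_lintegral (f := f) (μ := μ) (p := (k:NNReal))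
    (by simp; omega)
  calc ∫⁻ x, ENNReal.ofReal (|f x| ^ k) ∂μ = ∫⁻ x, ‖f x‖ₑ ^ ((k:NNReal):ℝ) ∂μ := by
        congr 1; ext x
        simp [ENNReal.ofReal_pow, Real.enorm_eq_ofReal_abs]
    _ = eLpNorm f ((k:NNReal):ENNReal) μ ^ ((k:NNReal):ℝ) := h3.symm
    _ ≤ ENNReal.ofReal B ^ ((k:NNReal):ℝ) := ENNReal.rpow_le_rpow h2 (by simp)
    _ = ENNReal.ofReal (B ^ k) := by simp [ENNReal.ofReal_pow hB0]

lemma piDen_measurable {V : ℝ → ℝ} (hV : Measurable V) : Measurable (piDen V) := by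
  unfold piDen; fun_prop

lemma piMeasure_prob {V : ℝ → ℝ} (hVint : Integrable (fun y => Real.exp (-V y))) :
    IsProbabilityMeasure (piMeasure V) := by
  have hpos : 0 < ∫ y, Real.exp (-V y) := integral_exp_pos hVint
  constructor
  rw [piMeasure, withDensity_apply _ MeasurableSet.univ, Measure.restrict_univ,
    ← ofReal_integral_eq_lintegral_ofReal]
  · unfold piDen
    rw [integral_div, div_self hpos.ne']; simp
  · unfold piDen; exact hVint.div_const _
  · exact Filter.Eventually.of_forall fun x => by unfold piDen; positivity

lemma pi_shift {V : ℝ → ℝ} (hV : Measurable V)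
    (F : ℝ → ℝ) (hF : Measurable F) (θ : ℝ) :
    ∫⁻ x, ENNReal.ofReal (Real.exp (V x - V (x + θ)) * F (V x - V (x + θ))) ∂(piMeasure V)
      = ∫⁻ x, ENNReal.ofReal (F (V (x + -θ) - V x)) ∂(piMeasure V) := by
  have hm := (piDen_measurable hV).ennreal_ofReal
  rw [piMeasure, lintegral_withDensity_eq_lintegral_mul _ hm (by fun_prop),
    lintegral_withDensity_eq_lintegral_mul _ hm (by fun_prop)]
  conv_rhs => rw [← lintegral_add_right_eq_self _ θ]
  congr 1; ext x
  have hI : 0 ≤ ∫ y, Real.exp (-V y) := integral_nonneg fun _ => (Real.exp_pos _).le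
  simp only [Pi.mul_apply, add_neg_cancel_right]
  rw [← ENNReal.ofReal_mul (by unfold piDen; positivity),
    ← ENNReal.ofReal_mul (by unfold piDen; positivity)]
  congr 1
  rw [← mul_assoc]; congr 1
  unfold piDen
  rw [div_mul_eq_mul_div, ← Real.exp_add]
  congr 2; ring

def rF (V Vdot : ℝ → ℝ) (θ x : ℝ) : ℝ := V (x + θ) - V x - θ * Vdot x

def gF (V Vdot : ℝ → ℝ) (θ x : ℝ) : ℝ :=
  2 * (Real.exp ((V x - V (x + θ)) / 2) - 1) + θ * Vdot x

def RF (V : ℝ → ℝ) (θ x : ℝ) : ℝ :=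
  (V x - V (x + θ)) - 2 * (Real.exp ((V x - V (x + θ)) / 2) - 1)
    + (Real.exp ((V x - V (x + θ)) / 2) - 1) ^ 2

def phiF (V Vdot : ℝ → ℝ) (θ x : ℝ) : ℝ :=
  |RF V θ x| + gF V Vdot θ x ^ 2 + rF V Vdot θ x ^ 2

def HF (C B β t : ℝ) : ℝ :=
  16 * ((C * t ^ β) ^ 3 + (B * t) ^ 3 + ((C * t ^ β) ^ 4 + (B * t) ^ 4)) + 3 * (C * t ^ β) ^ 2

lemma phiF_le (V Vdot : ℝ → ℝ) (θ x : ℝ) : phiF V Vdot θ x ≤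
    (|V x - V (x + θ)| ^ 3 + Real.exp (V x - V (x + θ)) * |V x - V (x + θ)| ^ 3)
    + (|V x - V (x + θ)| ^ 4 + Real.exp (V x - V (x + θ)) * |V x - V (x + θ)| ^ 4)
    + 3 * |rF V Vdot θ x| ^ 2 := by
  set D := V x - V (x + θ) with hD
  have h1 := aux_exp2 (D / 2)
  have h2 := aux_exp1 (D / 2)
  have e1 : 2 * (D / 2) = D := by ring
  rw [e1] at h1 h2
  rw [abs_div, abs_two] at h1
  have hg : gF V Vdot θ x = 2 * (Real.exp (D / 2) - 1 - D / 2) - rF V Vdot θ x := by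
    unfold gF rF; rw [← hD]; rw [hD]; ring
  have hR : RF V θ x = D - 2 * (Real.exp (D / 2) - 1) + (Real.exp (D / 2) - 1) ^ 2 := rfl
  unfold phiF
  rw [hg, hR, sq_abs]
  have h4 : |D| ^ 4 = D ^ 4 := by rw [← abs_pow]; exact abs_of_nonneg (by positivity)
  rw [h4]
  have h5 : 0 ≤ |D| ^ 3 * (1 + Real.exp D) := by positivity
  have h6 : 0 ≤ D ^ 4 * (1 + Real.exp D) := by positivity
  nlinarith [sq_nonneg (2 * (Real.exp (D / 2) - 1 - D / 2) + rF V Vdot θ x)]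

lemma abs_add_pow_le8 (a b : ℝ) (k : ℕ) (hk1 : k ≤ 4) :
    |a + b| ^ k ≤ 8 * (|a| ^ k + |b| ^ k) := by
  rcases Nat.eq_zero_or_pos k with rfl | hk
  · norm_num
  have h1 : |a + b| ^ k ≤ (|a| + |b|) ^ k := pow_le_pow_left₀ (abs_nonneg _) (abs_add_le a b) k
  have h2 := add_pow_le (abs_nonneg a) (abs_nonneg b) k
  have h3 : (2:ℝ) ^ (k - 1) ≤ 2 ^ 3 := pow_le_pow_right₀ (by norm_num) (by omega)
  have h4 : 0 ≤ |a| ^ k + |b| ^ k := by positivity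
  nlinarith [mul_le_mul_of_nonneg_right h3 h4]

section
variable {V Vdot : ℝ → ℝ} (hV : Measurable V) (hVdot : Measurable Vdot)
    (hVint : Integrable (fun y => Real.exp (-V y)))
    {p C β : ℝ} (hp : 4 < p) (hC : 0 < C) (hβ : 1 < β)
    (hH1i : ∀ θ : ℝ,
      Integrable (fun x => |V (x + θ) - V x - θ * Vdot x| ^ p) (piMeasure V) ∧
      (∫ x, |V (x + θ) - V x - θ * Vdot x| ^ p ∂(piMeasure V)) ^ (1 / p) ≤ C * |θ| ^ β)
    (hH1ii : Integrable (fun x => |Vdot x| ^ (6 : ℝ)) (piMeasure V))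
include hV hVdot hVint hp hC hβ hH1i hH1ii

lemma delta_pow (B : ℝ) (hB : B = (∫ x, |Vdot x| ^ (6:ℝ) ∂(piMeasure V)) ^ (1 / (6:ℝ)))
    (k : ℕ) (hk1 : 1 ≤ k) (hk : k ≤ 4) (θ : ℝ) :
    ∫⁻ x, ENNReal.ofReal (|V x - V (x + θ)| ^ k) ∂(piMeasure V)
      ≤ ENNReal.ofReal (8 * ((C * |θ| ^ β) ^ k + (B * |θ|) ^ k)) := by
  have := piMeasure_prob hVint
  have hB0 : 0 ≤ B := by rw [hB]; positivity
  have hk4 : (k:ℝ) ≤ 4 := by exact_mod_cast hk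
  have h1 := lyap (piMeasure V) (fun x => V (x + θ) - V x - θ * Vdot x) (by fun_prop) p _ k hk1
    (by linarith) (hH1i θ).1 (hH1i θ).2
  have h2 := lyap (piMeasure V) Vdot hVdot 6 B k hk1 (by linarith) hH1ii hB.ge
  calc ∫⁻ x, ENNReal.ofReal (|V x - V (x + θ)| ^ k) ∂(piMeasure V)
      ≤ ∫⁻ x, (8 * ENNReal.ofReal (|V (x + θ) - V x - θ * Vdot x| ^ k) +
          ENNReal.ofReal (8 * |θ| ^ k) * ENNReal.ofReal (|Vdot x| ^ k)) ∂(piMeasure V) := by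
        apply lintegral_mono
        intro x
        have := abs_add_pow_le8 (V (x + θ) - V x - θ * Vdot x) (θ * Vdot x) k hk
        rw [sub_add_cancel, abs_sub_comm, abs_mul θ, mul_pow] at this
        simp only
        rw [← ENNReal.ofReal_mul (by positivity)]
        rw [show (8:ENNReal) = ENNReal.ofReal 8 by simp, ← ENNReal.ofReal_mul (by norm_num),
          ← ENNReal.ofReal_add (by positivity) (by positivity)]
        apply ENNReal.ofReal_le_ofReal
        linarith
    _ = 8 * ∫⁻ x, ENNReal.ofReal (|V (x + θ) - V x - θ * Vdot x| ^ k) ∂(piMeasure V) +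
          ENNReal.ofReal (8 * |θ| ^ k) * ∫⁻ x, ENNReal.ofReal (|Vdot x| ^ k) ∂(piMeasure V) := by
        rw [lintegral_add_left (by fun_prop), lintegral_const_mul _ (by fun_prop),
          lintegral_const_mul _ (by fun_prop)]
    _ ≤ 8 * ENNReal.ofReal ((C * |θ| ^ β) ^ k) +
          ENNReal.ofReal (8 * |θ| ^ k) * ENNReal.ofReal (B ^ k) := by gcongr
    _ = _ := by
        rw [← ENNReal.ofReal_mul (by positivity)]
        rw [show (8:ENNReal) = ENNReal.ofReal 8 by simp, ← ENNReal.ofReal_mul (by norm_num),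
          ← ENNReal.ofReal_add (by positivity) (by positivity)]
        congr 1; rw [mul_pow B]; ring

lemma phi_lint (B : ℝ) (hB : B = (∫ x, |Vdot x| ^ (6:ℝ) ∂(piMeasure V)) ^ (1 / (6:ℝ))) (θ : ℝ) :
    ∫⁻ x, ENNReal.ofReal (phiF V Vdot θ x) ∂(piMeasure V) ≤ ENNReal.ofReal (HF C B β |θ|) := by
  have := piMeasure_prob hVint
  have hB0 : 0 ≤ B := by rw [hB]; positivity
  have h1 := delta_pow hV hVdot hVint hp hC hβ hH1i hH1ii B hB
  have h2 : ∀ (k : ℕ) (hk1 : 1 ≤ k) (hk : k ≤ 4),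
      ∫⁻ x, ENNReal.ofReal (Real.exp (V x - V (x + θ)) * |V x - V (x + θ)| ^ k) ∂(piMeasure V)
      ≤ ENNReal.ofReal (8 * ((C * |θ| ^ β) ^ k + (B * |θ|) ^ k)) := by
    intro k hk1 hk
    rw [pi_shift hV (fun y => |y| ^ k) (by fun_prop)]
    have := h1 k hk1 hk (-θ)
    simpa [abs_sub_comm] using this
  have h3 := lyap (piMeasure V) (rF V Vdot θ) (by unfold rF; fun_prop) p _ 2 (by norm_num)
    (by norm_num; linarith) (hH1i θ).1 (hH1i θ).2
  have hr : Measurable (rF V Vdot θ) := by unfold rF; fun_prop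
  calc _ ≤ ∫⁻ x, ((ENNReal.ofReal (|V x - V (x + θ)| ^ 3) +
            ENNReal.ofReal (Real.exp (V x - V (x + θ)) * |V x - V (x + θ)| ^ 3)) +
          (ENNReal.ofReal (|V x - V (x + θ)| ^ 4) +
            ENNReal.ofReal (Real.exp (V x - V (x + θ)) * |V x - V (x + θ)| ^ 4)) +
          ENNReal.ofReal 3 * ENNReal.ofReal (|rF V Vdot θ x| ^ 2)) ∂(piMeasure V) := by
        apply lintegral_mono
        intro x
        simp only
        rw [← ENNReal.ofReal_mul (by positivity), ← ENNReal.ofReal_add (by positivity) (by positivity),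
          ← ENNReal.ofReal_add (by positivity) (by positivity),
          ← ENNReal.ofReal_add (by positivity) (by positivity),
          ← ENNReal.ofReal_add (by positivity) (by positivity)]
        exact ENNReal.ofReal_le_ofReal (phiF_le V Vdot θ x)
    _ ≤ (ENNReal.ofReal (8 * ((C * |θ| ^ β) ^ 3 + (B * |θ|) ^ 3)) +
          ENNReal.ofReal (8 * ((C * |θ| ^ β) ^ 3 + (B * |θ|) ^ 3))) +
        (ENNReal.ofReal (8 * ((C * |θ| ^ β) ^ 4 + (B * |θ|) ^ 4)) +
          ENNReal.ofReal (8 * ((C * |θ| ^ β) ^ 4 + (B * |θ|) ^ 4))) +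
        ENNReal.ofReal 3 * ENNReal.ofReal ((C * |θ| ^ β) ^ 2) := by
        rw [lintegral_add_left (by fun_prop), lintegral_add_left (by fun_prop),
          lintegral_add_left (by fun_prop), lintegral_add_left (by fun_prop),
          lintegral_const_mul _ (by fun_prop)]
        gcongr
        · exact h1 3 (by norm_num) (by norm_num) θ
        · exact h2 3 (by norm_num) (by norm_num)
        · exact h1 4 (by norm_num) (by norm_num) θ
        · exact h2 4 (by norm_num) (by norm_num)
    _ = _ := by
        rw [← ENNReal.ofReal_mul (by positivity), ← ENNReal.ofReal_add (by positivity) (by positivity),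
          ← ENNReal.ofReal_add (by positivity) (by positivity),
          ← ENNReal.ofReal_add (by positivity) (by positivity),
          ← ENNReal.ofReal_add (by positivity) (by positivity)]
        congr 1; unfold HF; ring

lemma HF_scale (B : ℝ) (hB0 : 0 ≤ B) (σ t : ℝ) (hσ : 0 < σ) (hσ1 : σ ≤ 1) (ht : 0 ≤ t) :
    HF C B β (σ * t) ≤ σ ^ (min (2 * β) 3) * HF C B β t := by
  have key : ∀ (c : ℝ) (k : ℕ), min (2 * β) 3 ≤ c * k → (σ ^ c) ^ k ≤ σ ^ (min (2 * β) 3) := by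
    intro c k h
    rw [← Real.rpow_natCast, ← Real.rpow_mul hσ.le]
    exact Real.rpow_le_rpow_of_exponent_ge hσ hσ1 h
  have k1 : ∀ k : ℕ, 2 ≤ k → (C * (σ * t) ^ β) ^ k ≤ σ ^ (min (2 * β) 3) * (C * t ^ β) ^ k := by
    intro k hk
    have hk' : (2:ℝ) ≤ k := by exact_mod_cast hk
    rw [Real.mul_rpow hσ.le ht, show C * (σ ^ β * t ^ β) = σ ^ β * (C * t ^ β) by ring, mul_pow]
    gcongr
    apply key
    exact (min_le_left _ _).trans (by nlinarith)
  have k2 : ∀ k : ℕ, 3 ≤ k → (B * (σ * t)) ^ k ≤ σ ^ (min (2 * β) 3) * (B * t) ^ k := by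
    intro k hk
    have hk' : (3:ℝ) ≤ k := by exact_mod_cast hk
    rw [show B * (σ * t) = σ * (B * t) by ring, mul_pow]
    gcongr
    have := key 1 k ((min_le_right _ _).trans (by linarith))
    simpa using this
  unfold HF
  have a1 := k1 3 (by norm_num)
  have a2 := k1 4 (by norm_num)
  have a3 := k1 2 (by norm_num)
  have a4 := k2 3 (by norm_num)
  have a5 := k2 4 (by norm_num)
  linarith

end

lemma gauss_abs_rpow (c : ℝ) (hc : 0 < c) :
    Integrable (fun z : ℝ => |z| ^ c) (gaussianReal 0 1) := by
  have h := memLp_id_gaussianReal' (μ := 0) (v := 1) (ENNReal.ofReal c) ENNReal.ofReal_ne_top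
  have := h.integrable_norm_rpow (by simpa using hc) ENNReal.ofReal_ne_top
  simpa [ENNReal.toReal_ofReal hc.le] using this

lemma gauss_pow (k : ℕ) : Integrable (fun z : ℝ => z ^ k) (gaussianReal 0 1) := by
  rcases Nat.eq_zero_or_pos k with rfl | hk
  · simp
  · have := gauss_abs_rpow k (by exact_mod_cast hk)
    refine this.mono' (by fun_prop) (Filter.Eventually.of_forall fun z => ?_)
    simp

lemma gauss_second : ∫ z : ℝ, z ^ 2 ∂(gaussianReal 0 1) = 1 := by
  have h := variance_eq_sub (X := fun z : ℝ => z) (μ := gaussianReal 0 1)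
    (memLp_id_gaussianReal' 2 (by simp))
  rw [variance_fun_id_gaussianReal, integral_id_gaussianReal] at h
  simpa using h.symm

lemma gauss_HF (C B β ℓ : ℝ) (hβ : 1 < β) (hℓ : 0 < ℓ) :
    Integrable (fun z => HF C B β (ℓ * |z|)) (gaussianReal 0 1) := by
  have h1 : ∀ k : ℕ, 1 ≤ k → Integrable (fun z : ℝ => (C * (ℓ * |z|) ^ β) ^ k) (gaussianReal 0 1) := by
    intro k hk
    have hk' : (1:ℝ) ≤ k := by exact_mod_cast hk
    have := (gauss_abs_rpow (β * k) (by nlinarith)).const_mul ((C * ℓ ^ β) ^ k)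
    refine this.congr (Filter.Eventually.of_forall fun z => ?_)
    simp only
    rw [Real.mul_rpow hℓ.le (abs_nonneg z), Real.rpow_mul (abs_nonneg z), Real.rpow_natCast,
      ← mul_pow]
    ring
  have h2 : ∀ k : ℕ, 1 ≤ k → Integrable (fun z : ℝ => (B * (ℓ * |z|)) ^ k) (gaussianReal 0 1) := by
    intro k hk
    have hk' : (1:ℝ) ≤ k := by exact_mod_cast hk
    have := (gauss_abs_rpow k (by linarith)).const_mul ((B * ℓ) ^ k)
    refine this.congr (Filter.Eventually.of_forall fun z => ?_)
    simp only
    rw [Real.rpow_natCast, ← mul_pow]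
    ring
  unfold HF
  exact ((((h1 3 (by norm_num)).add (h2 3 (by norm_num))).add
    ((h1 4 (by norm_num)).add (h2 4 (by norm_num)))).const_mul 16).add
    ((h1 2 (by norm_num)).const_mul 3)

lemma cs_sqrt {Ω : Type*} [MeasurableSpace Ω] {μ : Measure Ω} {f g : Ω → ℝ}
    (hf : MemLp f 2 μ) (hg : MemLp g 2 μ) :
    ∫ x, |f x * g x| ∂μ ≤ Real.sqrt (∫ x, f x ^ 2 ∂μ) * Real.sqrt (∫ x, g x ^ 2 ∂μ) := by
  have h := integral_mul_le_Lp_mul_Lq_of_nonneg (μ := μ) (f := fun x => |f x|) (g := fun x => |g x|)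
    (p := 2) (q := 2) (by constructor <;> norm_num)
    (Filter.Eventually.of_forall fun x => abs_nonneg _)
    (Filter.Eventually.of_forall fun x => abs_nonneg _)
    (by simpa using hf.norm) (by simpa using hg.norm)
  rw [Real.sqrt_eq_rpow, Real.sqrt_eq_rpow]
  simpa [abs_mul] using h

lemma abs_le_sqrt_sq {Ω : Type*} [MeasurableSpace Ω] {μ : Measure Ω} [IsProbabilityMeasure μ]
    {f : Ω → ℝ} (hf : MemLp f 2 μ) :
    ∫ x, |f x| ∂μ ≤ Real.sqrt (∫ x, f x ^ 2 ∂μ) := by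
  have := cs_sqrt hf (memLp_const (1:ℝ))
  simpa using this

lemma sum_bound {Ω : Type*} [MeasurableSpace Ω] (P : Measure Ω) [IsProbabilityMeasure P]
    (n : ℕ) (M N : Ω → ℝ) (hM : MemLp M 2 P) (hM0 : ∫ x, M x ∂P = 0) (hN : Integrable N P)
    (s : Finset (Fin n)) :
    Integrable (fun w : Fin n → Ω => ∑ i ∈ s, (M (w i) + N (w i))) (Measure.pi fun _ => P) ∧
    ∫ w, |∑ i ∈ s, (M (w i) + N (w i))| ∂(Measure.pi fun _ : Fin n => P)
      ≤ Real.sqrt (n * ∫ x, M x ^ 2 ∂P) + n * ∫ x, |N x| ∂P := by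
  classical
  set μ := Measure.pi fun _ : Fin n => P
  have hev : ∀ i : Fin n, MeasurePreserving (Function.eval i) μ P :=
    fun i => measurePreserving_eval (fun _ => P) i
  have hMi : ∀ i : Fin n, MemLp (fun w : Fin n → Ω => M (w i)) 2 μ :=
    fun i => hM.comp_measurePreserving (hev i)
  have hNi : ∀ i : Fin n, Integrable (fun w : Fin n → Ω => N (w i)) μ :=
    fun i => (hev i).integrable_comp_of_integrable hN
  have hint : ∀ i : Fin n, ∀ f : Ω → ℝ, AEStronglyMeasurable f P →
      ∫ w, f (w i) ∂μ = ∫ x, f x ∂P := by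
    intro i f hf
    have := integral_map (hev i).measurable.aemeasurable (f := f) (by rwa [(hev i).map_eq])
    rw [(hev i).map_eq] at this
    exact this.symm
  have hS : MemLp (fun w : Fin n → Ω => ∑ i ∈ s, M (w i)) 2 μ := memLp_finsetSum s fun i _ => hMi i
  have hT : Integrable (fun w : Fin n → Ω => ∑ i ∈ s, N (w i)) μ :=
    integrable_finsetSum s fun i _ => hNi i
  have hsplit : (fun w : Fin n → Ω => ∑ i ∈ s, (M (w i) + N (w i)))
      = fun w => (∑ i ∈ s, M (w i)) + ∑ i ∈ s, N (w i) := by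
    ext w; exact Finset.sum_add_distrib
  have hSi := hS.integrable (by norm_num)
  refine ⟨by rw [hsplit]; exact hSi.add hT, ?_⟩
  -- second moment
  have hI0 : 0 ≤ ∫ x, M x ^ 2 ∂P := integral_nonneg fun _ => sq_nonneg _
  have hJ0 : 0 ≤ ∫ x, |N x| ∂P := integral_nonneg fun _ => abs_nonneg _
  have hcard : (s.card : ℝ) ≤ n := by
    have := s.card_le_univ; simp at this; exact_mod_cast this
  have hvar : ∫ w, (∑ i ∈ s, M (w i)) ^ 2 ∂μ ≤ n * ∫ x, M x ^ 2 ∂P := by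
    have h0 : ∫ w, (∑ i ∈ s, M (w i)) ∂μ = 0 := by
      rw [integral_finsetSum _ fun i _ => (hMi i).integrable (by norm_num)]
      apply Finset.sum_eq_zero
      intro i _
      rw [hint i M hM.1, hM0]
    have h1 := variance_sum_pi (μ := fun _ : Fin n => P) (X := fun i => if i ∈ s then M else 0)
      (fun i => by split_ifs; exacts [hM, MemLp.zero'])
    have h2 : (∑ i, fun ω : Fin n → Ω => (if i ∈ s then M else 0) (ω i)) =
        fun w => ∑ i ∈ s, M (w i) := by
      ext w
      rw [Finset.sum_apply, ← Finset.sum_filter_add_sum_filter_not Finset.univ (fun i => i ∈ s)]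
      rw [Finset.sum_congr rfl (g := fun i => M (w i)), Finset.sum_eq_zero (s := {i | i ∉ s})]
      · simp
      · intro i hi; simp at hi; simp [hi]
      · intro i hi; simp at hi; simp [hi]
    rw [h2, variance_of_integral_eq_zero hS.1.aemeasurable h0] at h1
    rw [h1]
    have h3 : ∀ i : Fin n, Var[(if i ∈ s then M else 0); P] ≤ ∫ x, M x ^ 2 ∂P := by
      intro i
      split_ifs
      · rw [variance_of_integral_eq_zero hM.1.aemeasurable hM0]
      · rw [variance_zero]; exact hI0
    calc _ ≤ ∑ i : Fin n, ∫ x, M x ^ 2 ∂P := Finset.sum_le_sum fun i _ => h3 i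
      _ = _ := by simp
  have hA : ∫ w, |∑ i ∈ s, M (w i)| ∂μ ≤ Real.sqrt (n * ∫ x, M x ^ 2 ∂P) :=
    (abs_le_sqrt_sq hS).trans (Real.sqrt_le_sqrt hvar)
  have hBd : ∫ w, |∑ i ∈ s, N (w i)| ∂μ ≤ n * ∫ x, |N x| ∂P := by
    calc _ ≤ ∫ w, ∑ i ∈ s, |N (w i)| ∂μ := by
          apply integral_mono hT.abs (integrable_finsetSum s fun i _ => (hNi i).abs)
          intro w; exact Finset.abs_sum_le_sum_abs _ _
      _ = ∑ i ∈ s, ∫ x, |N x| ∂P := by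
          rw [integral_finsetSum s fun i _ => (hNi i).abs]
          exact Finset.sum_congr rfl fun i _ => hint i (fun x => |N x|) hN.abs.1
      _ = s.card * ∫ x, |N x| ∂P := by simp
      _ ≤ _ := by gcongr
  calc _ ≤ ∫ w, (|∑ i ∈ s, M (w i)| + |∑ i ∈ s, N (w i)|) ∂μ := by
        apply integral_mono
        · simp only [Finset.sum_add_distrib]; exact (hSi.add hT).abs
        · exact hSi.abs.add hT.abs
        · intro w
          simp only
          rw [Finset.sum_add_distrib]; exact abs_add_le _ _
    _ = _ := integral_add hSi.abs hT.abs
    _ ≤ _ := add_le_add hA hBd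

section
variable {V Vdot : ℝ → ℝ} (hV : Measurable V) (hVdot : Measurable Vdot)
    (hVint : Integrable (fun y => Real.exp (-V y)))
    {p C β : ℝ} (hp : 4 < p) (hC : 0 < C) (hβ : 1 < β)
    (hH1i : ∀ θ : ℝ,
      Integrable (fun x => |V (x + θ) - V x - θ * Vdot x| ^ p) (piMeasure V) ∧
      (∫ x, |V (x + θ) - V x - θ * Vdot x| ^ p ∂(piMeasure V)) ^ (1 / p) ≤ C * |θ| ^ β)
    (hH1ii : Integrable (fun x => |Vdot x| ^ (6 : ℝ)) (piMeasure V))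
    {ℓ : ℝ} (hℓ : 0 < ℓ)
include hV hVdot hVint hp hC hβ hH1i hH1ii hℓ

lemma phi_prod : ∃ κ : ℝ, 0 ≤ κ ∧ ∀ n : ℕ, 1 ≤ n →
    Integrable (fun q : ℝ × ℝ => phiF V Vdot (ℓ * q.2 / Real.sqrt n) q.1)
      ((piMeasure V).prod (gaussianReal 0 1)) ∧
    ∫ q : ℝ × ℝ, phiF V Vdot (ℓ * q.2 / Real.sqrt n) q.1
      ∂((piMeasure V).prod (gaussianReal 0 1)) ≤ (1 / Real.sqrt n) ^ (min (2 * β) 3) * κ := by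
  have := piMeasure_prob hVint
  obtain ⟨B, hB⟩ : ∃ B, B = (∫ x, |Vdot x| ^ (6:ℝ) ∂(piMeasure V)) ^ (1 / (6:ℝ)) := ⟨_, rfl⟩
  have hB0 : 0 ≤ B := by rw [hB]; positivity
  have hH0 : ∀ t : ℝ, 0 ≤ t → 0 ≤ HF C B β t := by
    intro t ht; unfold HF; positivity
  have hHnn : ∀ z : ℝ, 0 ≤ HF C B β (ℓ * |z|) := fun z => hH0 _ (by positivity)
  have hκ : 0 ≤ ∫ z, HF C B β (ℓ * |z|) ∂(gaussianReal 0 1) := integral_nonneg hHnn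
  refine ⟨∫ z, HF C B β (ℓ * |z|) ∂(gaussianReal 0 1), hκ, ?_⟩
  intro n hn
  have hn' : (1:ℝ) ≤ n := by exact_mod_cast hn
  have hs : (1:ℝ) ≤ Real.sqrt n := Real.one_le_sqrt.mpr hn'
  obtain ⟨σ, hσ⟩ : ∃ σ, σ = 1 / Real.sqrt n := ⟨_, rfl⟩
  rw [← hσ]
  have hσ0 : 0 < σ := by rw [hσ]; positivity
  obtain ⟨κ, hκe⟩ : ∃ κ, κ = ∫ z, HF C B β (ℓ * |z|) ∂(gaussianReal 0 1) := ⟨_, rfl⟩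
  rw [← hκe] at hκ ⊢
  have hσ1 : σ ≤ 1 := by rw [hσ, div_le_one (by linarith)]; exact hs
  have hmeas : Measurable (fun q : ℝ × ℝ => phiF V Vdot (ℓ * q.2 / Real.sqrt n) q.1) := by
    unfold phiF RF gF rF; fun_prop
  have hnn : ∀ q : ℝ × ℝ, 0 ≤ phiF V Vdot (ℓ * q.2 / Real.sqrt n) q.1 := by
    intro q; unfold phiF; positivity
  have hl : ∫⁻ q : ℝ × ℝ, ENNReal.ofReal (phiF V Vdot (ℓ * q.2 / Real.sqrt n) q.1)
      ∂((piMeasure V).prod (gaussianReal 0 1)) ≤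
      ENNReal.ofReal (σ ^ (min (2 * β) 3) * κ) := by
    rw [lintegral_prod_symm' _ hmeas.ennreal_ofReal]
    calc _ ≤ ∫⁻ z, ENNReal.ofReal (σ ^ (min (2 * β) 3) * HF C B β (ℓ * |z|))
            ∂(gaussianReal 0 1) := by
          apply lintegral_mono
          intro z
          have h := phi_lint hV hVdot hVint hp hC hβ hH1i hH1ii B hB (ℓ * z / Real.sqrt n)
          have : |ℓ * z / Real.sqrt n| = σ * (ℓ * |z|) := by
            rw [abs_div, abs_mul, abs_of_pos hℓ, abs_of_nonneg (Real.sqrt_nonneg _), hσ]; ring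
          rw [this] at h
          refine h.trans (ENNReal.ofReal_le_ofReal ?_)
          exact HF_scale hV hVdot hVint hp hC hβ hH1i hH1ii B hB0 σ _ hσ0 hσ1 (by positivity)
      _ = _ := by
          rw [← ofReal_integral_eq_lintegral_ofReal
            ((gauss_HF C B β ℓ hβ hℓ).const_mul _)
            (Filter.Eventually.of_forall fun z => mul_nonneg (by positivity) (hHnn z)),
            integral_const_mul, hκe]
  constructor
  · refine ⟨hmeas.aestronglyMeasurable, ?_⟩
    rw [hasFiniteIntegral_iff_ofReal (Filter.Eventually.of_forall hnn)]
    exact hl.trans_lt ENNReal.ofReal_lt_top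
  · rw [integral_eq_lintegral_of_nonneg_ae (Filter.Eventually.of_forall hnn)
      hmeas.aestronglyMeasurable]
    exact ENNReal.toReal_le_of_le_ofReal (by positivity) hl

omit hC hβ hp hH1i hℓ in
lemma Vdot_pow (k : ℕ) (hk : k ≤ 6) : Integrable (fun x => Vdot x ^ k) (piMeasure V) := by
  have := piMeasure_prob hVint
  have h6 : MemLp Vdot (ENNReal.ofReal 6) (piMeasure V) := by
    rw [← integrable_norm_rpow_iff hVdot.aestronglyMeasurable (by simp) ENNReal.ofReal_ne_top]
    simpa using hH1ii
  rcases Nat.eq_zero_or_pos k with rfl | hk0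
  · simp
  have hkm : MemLp Vdot (k : ENNReal) (piMeasure V) := by
    apply h6.mono_exponent
    rw [← ENNReal.ofReal_natCast]
    apply ENNReal.ofReal_le_ofReal
    exact_mod_cast hk
  have := hkm.integrable_norm_rpow (by simp; omega) (by simp)
  refine this.mono' (by fun_prop) (Filter.Eventually.of_forall fun x => ?_)
  simp

/-- The one-dimensional estimates. -/
lemma one_dim (n : ℕ) (hn : 1 ≤ n) (ε : ℝ)
    (hphi : Integrable (fun q : ℝ × ℝ => phiF V Vdot (ℓ * q.2 / Real.sqrt n) q.1)
      ((piMeasure V).prod (gaussianReal 0 1)))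
    (hI : ∫ q : ℝ × ℝ, phiF V Vdot (ℓ * q.2 / Real.sqrt n) q.1
      ∂((piMeasure V).prod (gaussianReal 0 1)) ≤ ε) :
    ∃ M N : ℝ × ℝ → ℝ, MemLp M 2 ((piMeasure V).prod (gaussianReal 0 1)) ∧
      ∫ q, M q ∂((piMeasure V).prod (gaussianReal 0 1)) = 0 ∧
      Integrable N ((piMeasure V).prod (gaussianReal 0 1)) ∧
      (∀ q : ℝ × ℝ, dV V ℓ n q.1 q.2 - bFun V Vdot ℓ n q.1 q.2 = M q + N q) ∧
      ∫ q, M q ^ 2 ∂((piMeasure V).prod (gaussianReal 0 1)) ≤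
        2 * ε + 2 * ((ℓ ^ 2 / (4 * n)) ^ 2 *
          ((∫ x, Vdot x ^ 4 ∂(piMeasure V)) * ∫ z : ℝ, (z ^ 2 - 1) ^ 2 ∂(gaussianReal 0 1))) ∧
      ∫ q, |N q| ∂((piMeasure V).prod (gaussianReal 0 1)) ≤
        ε + (1 / 4) * (ε + 2 * (Real.sqrt ε *
          Real.sqrt (ℓ ^ 2 / n * ∫ x, Vdot x ^ 2 ∂(piMeasure V)))) := by
  have := piMeasure_prob hVint
  set P := (piMeasure V).prod (gaussianReal 0 1) with hP
  have hn0 : (0:ℝ) < n := by exact_mod_cast hn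
  have hsq : Real.sqrt n ^ 2 = n := Real.sq_sqrt hn0.le
  have hsp : 0 < Real.sqrt n := Real.sqrt_pos.mpr hn0
  set θ : ℝ × ℝ → ℝ := fun q => ℓ * q.2 / Real.sqrt n with hθ
  have hθ2 : ∀ q, θ q ^ 2 = ℓ ^ 2 / n * q.2 ^ 2 := by
    intro q; simp only [hθ]; rw [div_pow, hsq]; ring
  set g : ℝ × ℝ → ℝ := fun q => gF V Vdot (θ q) q.1 with hg
  set R : ℝ × ℝ → ℝ := fun q => RF V (θ q) q.1 with hR
  set a : ℝ × ℝ → ℝ := fun q => θ q * Vdot q.1 with ha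
  have hgm : Measurable g := by simp only [hg, hθ]; unfold gF; fun_prop
  have hRm : Measurable R := by simp only [hR, hθ]; unfold RF; fun_prop
  have ham : Measurable a := by simp only [ha, hθ]; fun_prop
  have hphieq : ∀ q : ℝ × ℝ, phiF V Vdot (θ q) q.1 = |R q| + g q ^ 2 + rF V Vdot (θ q) q.1 ^ 2 :=
    fun q => rfl
  have hg2i : Integrable (fun q => g q ^ 2) P := by
    refine hphi.mono' (by fun_prop) (Filter.Eventually.of_forall fun q => ?_)
    rw [Real.norm_of_nonneg (sq_nonneg _), hphieq]
    have := abs_nonneg (R q); nlinarith [sq_nonneg (rF V Vdot (θ q) q.1)]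
  have hRi : Integrable R P := by
    refine hphi.mono' (by fun_prop) (Filter.Eventually.of_forall fun q => ?_)
    rw [Real.norm_eq_abs, hphieq]
    nlinarith [sq_nonneg (rF V Vdot (θ q) q.1), sq_nonneg (g q)]
  have hg2 : MemLp g 2 P := (memLp_two_iff_integrable_sq hgm.aestronglyMeasurable).mpr hg2i
  have hgε : ∫ q, g q ^ 2 ∂P ≤ ε := by
    refine le_trans (integral_mono hg2i hphi fun q => ?_) hI
    simp only
    rw [hphieq]
    have := abs_nonneg (R q); nlinarith [sq_nonneg (rF V Vdot (θ q) q.1)]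
  have hRε : ∫ q, |R q| ∂P ≤ ε := by
    refine le_trans (integral_mono hRi.abs hphi fun q => ?_) hI
    simp only
    rw [hphieq]
    nlinarith [sq_nonneg (rF V Vdot (θ q) q.1), sq_nonneg (g q)]
  have hV2 := Vdot_pow hV hVdot hVint hH1ii 2 (by norm_num)
  have hV4 := Vdot_pow hV hVdot hVint hH1ii 4 (by norm_num)
  have hV1 := Vdot_pow hV hVdot hVint hH1ii 1 (by norm_num)
  have ha2e : (fun q => a q ^ 2) = fun q : ℝ × ℝ => ℓ ^ 2 / n * (Vdot q.1 ^ 2 * q.2 ^ 2) := by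
    ext q; simp only [ha]; rw [mul_pow, hθ2]; ring
  have ha2i : Integrable (fun q => a q ^ 2) P := by
    rw [ha2e]; exact (hV2.mul_prod (gauss_pow 2)).const_mul _
  have ha2 : MemLp a 2 P := (memLp_two_iff_integrable_sq ham.aestronglyMeasurable).mpr ha2i
  have ha2v : ∫ q, a q ^ 2 ∂P = ℓ ^ 2 / n * ∫ x, Vdot x ^ 2 ∂(piMeasure V) := by
    rw [ha2e, integral_const_mul, integral_prod_mul (fun x => Vdot x ^ 2) (fun z : ℝ => z ^ 2),
      gauss_second, mul_one]
  have ha0 : ∫ q, a q ∂P = 0 := by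
    have : a = fun q : ℝ × ℝ => ℓ / Real.sqrt n * (Vdot q.1 * q.2) := by
      ext q; simp only [ha, hθ]; ring
    rw [this, integral_const_mul, integral_prod_mul Vdot (fun z : ℝ => z), integral_id_gaussianReal]
    simp
  -- zeta
  have hz : ∀ q : ℝ × ℝ, zeta V ℓ n q.1 q.2 = (g q - a q) / 2 := by
    intro q; simp only [zeta, hg, ha, hθ, gF]; ring
  have hgi := hg2.integrable (by norm_num)
  have hai := ha2.integrable (by norm_num)
  have hzint : 2 * ∫ q : ℝ × ℝ, zeta V ℓ n q.1 q.2 ∂P = ∫ q, g q ∂P := by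
    simp only [hz]
    rw [integral_div, integral_sub hgi hai, ha0]; ring
  set m := ∫ q, g q ∂P with hm
  set c : ℝ × ℝ → ℝ := fun q => ℓ ^ 2 / (4 * n) * (Vdot q.1 ^ 2 * (q.2 ^ 2 - 1)) with hc
  have hcm : Measurable c := by simp only [hc]; fun_prop
  have hgz2 : Integrable (fun z : ℝ => z ^ 2 - 1) (gaussianReal 0 1) :=
    (gauss_pow 2).sub (integrable_const 1)
  have hgz4 : Integrable (fun z : ℝ => (z ^ 2 - 1) ^ 2) (gaussianReal 0 1) := by
    have : (fun z : ℝ => (z ^ 2 - 1) ^ 2) = fun z => z ^ 4 - 2 * z ^ 2 + 1 := by ext z; ring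
    rw [this]
    exact ((gauss_pow 4).sub ((gauss_pow 2).const_mul 2)).add (integrable_const 1)
  have hc2e : (fun q => c q ^ 2) = fun q : ℝ × ℝ =>
      (ℓ ^ 2 / (4 * n)) ^ 2 * (Vdot q.1 ^ 4 * (q.2 ^ 2 - 1) ^ 2) := by
    ext q; simp only [hc]; ring
  have hc2i : Integrable (fun q => c q ^ 2) P := by
    rw [hc2e]; exact (hV4.mul_prod hgz4).const_mul _
  have hc2 : MemLp c 2 P := (memLp_two_iff_integrable_sq hcm.aestronglyMeasurable).mpr hc2i
  have hc2v : ∫ q, c q ^ 2 ∂P = (ℓ ^ 2 / (4 * n)) ^ 2 *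
          ((∫ x, Vdot x ^ 4 ∂(piMeasure V)) * ∫ z : ℝ, (z ^ 2 - 1) ^ 2 ∂(gaussianReal 0 1)) := by
    rw [hc2e, integral_const_mul,
      integral_prod_mul (fun x => Vdot x ^ 4) (fun z : ℝ => (z ^ 2 - 1) ^ 2)]
  have hc0 : ∫ q, c q ∂P = 0 := by
    simp only [hc]
    rw [integral_const_mul, integral_prod_mul (fun x => Vdot x ^ 2) (fun z : ℝ => z ^ 2 - 1),
      integral_sub (gauss_pow 2) (integrable_const 1), gauss_second]
    simp
  have hci := hc2.integrable (by norm_num)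
  have hgm2 : MemLp (fun q => g q - m) 2 P := hg2.sub (memLp_const m)
  refine ⟨fun q => (g q - m) - c q, fun q => R q - (1 / 4) * (g q * (g q - 2 * a q)),
    hgm2.sub hc2, ?_, ?_, ?_, ?_, ?_⟩
  · rw [integral_sub (hgm2.integrable (by norm_num)) hci, hc0,
      integral_sub hgi (integrable_const m)]
    simp [hm]
  · exact hRi.sub ((hg2.integrable_mul (hg2.sub (ha2.const_mul 2))).const_mul _)
  · intro q
    have hb : bFun V Vdot ℓ n q.1 q.2 = -(θ q) * Vdot q.1 + m - ℓ ^ 2 / (4 * n) * Vdot q.1 ^ 2 := by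
      unfold bFun; rw [hzint]
    have hgq : g q = 2 * (Real.exp ((V q.1 - V (q.1 + θ q)) / 2) - 1) + θ q * Vdot q.1 := rfl
    have hRq : R q = (V q.1 - V (q.1 + θ q)) - 2 * (Real.exp ((V q.1 - V (q.1 + θ q)) / 2) - 1)
      + (Real.exp ((V q.1 - V (q.1 + θ q)) / 2) - 1) ^ 2 := rfl
    have hd : dV V ℓ n q.1 q.2 = V q.1 - V (q.1 + θ q) := rfl
    have hcq : c q = (1 / 4) * (θ q * Vdot q.1) ^ 2 - ℓ ^ 2 / (4 * n) * Vdot q.1 ^ 2 := by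
      rw [mul_pow, hθ2]; simp only [hc]; field_simp
    simp only
    rw [hb, hd, hcq, hRq, hgq]
    simp only [ha]
    ring
  · have h1 : ∫ q, (g q - m) ^ 2 ∂P ≤ ε := by
      have hv := variance_eq_integral (μ := P) hgm.aemeasurable
      have hv2 := variance_le_expectation_sq (μ := P) hgm.aestronglyMeasurable
      simp only [Pi.pow_apply] at hv2
      rw [hv] at hv2
      exact hv2.trans hgε
    calc ∫ q, ((g q - m) - c q) ^ 2 ∂P ≤ ∫ q, (2 * (g q - m) ^ 2 + 2 * c q ^ 2) ∂P := by
          apply integral_mono (hgm2.sub hc2).integrable_sq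
            ((hgm2.integrable_sq.const_mul 2).add (hc2i.const_mul 2))
          intro q
          simp only [Pi.sub_apply, Pi.add_apply]
          nlinarith [sq_nonneg ((g q - m) + c q)]
      _ = 2 * ∫ q, (g q - m) ^ 2 ∂P + 2 * ∫ q, c q ^ 2 ∂P := by
          rw [integral_add (hgm2.integrable_sq.const_mul 2) (hc2i.const_mul 2),
            integral_const_mul, integral_const_mul]
      _ ≤ _ := by rw [hc2v]; linarith
  · have hga : Integrable (fun q => |g q * a q|) P := (hg2.integrable_mul ha2).abs
    have haux : Integrable (fun q => (1 / 4) * (g q ^ 2 + 2 * |g q * a q|)) P :=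
      (hg2i.add (hga.const_mul 2)).const_mul (1 / 4)
    have hcs := cs_sqrt hg2 ha2
    rw [ha2v] at hcs
    have hcs2 : Real.sqrt (∫ q, g q ^ 2 ∂P) ≤ Real.sqrt ε := Real.sqrt_le_sqrt hgε
    have hcs3 := hcs.trans (mul_le_mul_of_nonneg_right hcs2 (Real.sqrt_nonneg _))
    calc _ ≤ ∫ q, (|R q| + (1 / 4) * (g q ^ 2 + 2 * |g q * a q|)) ∂P := by
          apply integral_mono
          · exact (hRi.sub ((hg2.integrable_mul (hg2.sub (ha2.const_mul 2))).const_mul (1 / 4))).abs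
          · exact hRi.abs.add ((hg2i.add (hga.const_mul 2)).const_mul _)
          · intro q
            simp only
            refine (abs_sub _ _).trans ?_
            have : |1 / 4 * (g q * (g q - 2 * a q))| ≤ 1 / 4 * (g q ^ 2 + 2 * |g q * a q|) := by
              rw [abs_le]
              constructor
              · nlinarith [le_abs_self (g q * a q), neg_abs_le (g q * a q), sq_nonneg (g q)]
              · nlinarith [le_abs_self (g q * a q), neg_abs_le (g q * a q), sq_nonneg (g q)]
            linarith
      _ = (∫ q, |R q| ∂P) + (1 / 4) * ((∫ q, g q ^ 2 ∂P) + 2 * ∫ q, |g q * a q| ∂P) := by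
          rw [integral_add hRi.abs haux, integral_const_mul,
            integral_add hg2i (hga.const_mul 2), integral_const_mul]
      _ ≤ _ := by linarith

end

lemma min_exp_le_aux {x y : ℝ} (h : x ≤ y) :
    |min 1 (Real.exp x) - min 1 (Real.exp y)| ≤ |x - y| := by
  have hm : min 1 (Real.exp x) ≤ min 1 (Real.exp y) :=
    min_le_min le_rfl (Real.exp_le_exp.mpr h)
  rw [abs_sub_comm, abs_of_nonneg (by linarith), abs_sub_comm, abs_of_nonneg (by linarith)]
  rcases le_total 0 x with hx | hx
  · have h1 : min 1 (Real.exp x) = 1 := min_eq_left (Real.one_le_exp hx)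
    have h2 : min 1 (Real.exp y) ≤ 1 := min_le_left _ _
    linarith
  · have h1 : min 1 (Real.exp x) = Real.exp x := min_eq_right (Real.exp_le_one_iff.mpr hx)
    rw [h1]
    rcases le_total 0 y with hy | hy
    · have h2 : min 1 (Real.exp y) ≤ 1 := min_le_left _ _
      linarith [Real.add_one_le_exp x]
    · have h2 : min 1 (Real.exp y) ≤ Real.exp y := min_le_right _ _
      have h3 : Real.exp y ≤ 1 := Real.exp_le_one_iff.mpr hy
      have h4 : Real.exp x = Real.exp y * Real.exp (x - y) := by rw [← Real.exp_add]; congr 1; ring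
      have h5 := Real.add_one_le_exp (x - y)
      nlinarith [Real.exp_pos y]

lemma min_exp_le (x y : ℝ) : |min 1 (Real.exp x) - min 1 (Real.exp y)| ≤ |x - y| := by
  rcases le_total x y with h | h
  · exact min_exp_le_aux h
  · rw [abs_sub_comm, abs_sub_comm x y]; exact min_exp_le_aux h

lemma min_exp_le_one (x y : ℝ) : |min 1 (Real.exp x) - min 1 (Real.exp y)| ≤ 1 := by
  have h1 : min 1 (Real.exp x) ≤ 1 := min_le_left _ _
  have h2 : min 1 (Real.exp y) ≤ 1 := min_le_left _ _
  have h3 : 0 ≤ min 1 (Real.exp x) := le_min zero_le_one (Real.exp_pos _).le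
  have h4 : 0 ≤ min 1 (Real.exp y) := le_min zero_le_one (Real.exp_pos _).le
  rw [abs_le]; constructor <;> linarith

def bnd (ℓ K m2 n ε : ℝ) : ℝ :=
  Real.sqrt ε + (Real.sqrt (n * (2 * ε + 2 * ((ℓ ^ 2 / (4 * n)) ^ 2 * K)))
    + n * (ε + (1 / 4) * (ε + 2 * (Real.sqrt ε * Real.sqrt (ℓ ^ 2 / n * m2)))))

lemma eps_tendsto (κ a : ℝ) (ha : 2 < a) :
    Tendsto (fun d : ℕ => ((d + 1 : ℕ) : ℝ) * ((1 / Real.sqrt ((d + 1 : ℕ) : ℝ)) ^ a * κ))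
      atTop (𝓝 0) := by
  have h1 := tendsto_rpow_neg_atTop (y := a / 2 - 1) (by linarith)
  have h2 : Tendsto (fun d : ℕ => ((d + 1 : ℕ) : ℝ)) atTop atTop :=
    tendsto_natCast_atTop_atTop.comp (tendsto_add_atTop_nat 1)
  have h3 := (h1.comp h2).mul_const κ
  rw [zero_mul] at h3
  refine h3.congr fun d => ?_
  have hn : (0:ℝ) < ((d + 1 : ℕ) : ℝ) := by positivity
  simp only [Function.comp]
  generalize ((d + 1 : ℕ) : ℝ) = n at hn ⊢
  rw [← mul_assoc, one_div, Real.sqrt_eq_rpow, ← Real.rpow_neg hn.le, ← Real.rpow_mul hn.le]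
  congr 1
  rw [show -(a / 2 - 1) = 1 + -(1 / 2) * a by ring, Real.rpow_add hn, Real.rpow_one]

lemma bnd_tendsto (ℓ K m2 : ℝ) (hm2 : 0 ≤ m2) (ε : ℕ → ℝ) (hε0 : ∀ d, 0 ≤ ε d)
    (hε : Tendsto (fun d : ℕ => ((d + 1 : ℕ) : ℝ) * ε d) atTop (𝓝 0)) :
    Tendsto (fun d : ℕ => bnd ℓ K m2 ((d + 1 : ℕ) : ℝ) (ε d)) atTop (𝓝 0) := by
  have hpos : ∀ d : ℕ, (1:ℝ) ≤ ((d + 1 : ℕ) : ℝ) := fun d => by push_cast; linarith [d.cast_nonneg (α := ℝ)]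
  have hε1 : Tendsto ε atTop (𝓝 0) :=
    squeeze_zero hε0 (fun d => by nlinarith [hpos d, hε0 d]) hε
  have hinv : Tendsto (fun d : ℕ => (((d + 1 : ℕ) : ℝ))⁻¹) atTop (𝓝 0) :=
    tendsto_inv_atTop_zero.comp (tendsto_natCast_atTop_atTop.comp (tendsto_add_atTop_nat 1))
  have e : ∀ d : ℕ, Real.sqrt (ε d) + (Real.sqrt (2 * (((d + 1 : ℕ) : ℝ) * ε d)
        + ℓ ^ 4 * K / 8 * (((d + 1 : ℕ) : ℝ))⁻¹)
      + ((5 / 4) * (((d + 1 : ℕ) : ℝ) * ε d)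
        + (1 / 2) * (Real.sqrt (((d + 1 : ℕ) : ℝ) * ε d) * Real.sqrt (ℓ ^ 2 * m2))))
      = bnd ℓ K m2 ((d + 1 : ℕ) : ℝ) (ε d) := by
    intro d
    have hn := hpos d
    have he := hε0 d
    generalize ((d + 1 : ℕ) : ℝ) = n at hn
    have hn0 : 0 < n := by linarith
    unfold bnd
    have h1 : n * (Real.sqrt (ε d) * Real.sqrt (ℓ ^ 2 / n * m2)) =
        Real.sqrt (n * ε d) * Real.sqrt (ℓ ^ 2 * m2) := by
      rw [← Real.sqrt_mul he, ← Real.sqrt_mul (by positivity)]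
      nth_rewrite 1 [← Real.sqrt_sq hn0.le]
      rw [← Real.sqrt_mul (by positivity)]
      congr 1; field_simp
    have h2 : n * (2 * ε d + 2 * ((ℓ ^ 2 / (4 * n)) ^ 2 * K)) =
        2 * (n * ε d) + ℓ ^ 4 * K / 8 * n⁻¹ := by
      field_simp; ring
    rw [h2, ← h1]; ring
  refine Tendsto.congr e ?_
  have t1 := (Real.continuous_sqrt.tendsto 0).comp hε1
  have t2 := (Real.continuous_sqrt.tendsto 0).comp hε
  have t3 : Tendsto (fun d : ℕ => 2 * (((d + 1 : ℕ) : ℝ) * ε d)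
        + ℓ ^ 4 * K / 8 * (((d + 1 : ℕ) : ℝ))⁻¹) atTop (𝓝 0) := by
    simpa using (hε.const_mul 2).add (hinv.const_mul (ℓ ^ 4 * K / 8))
  have t4 := (Real.continuous_sqrt.tendsto 0).comp t3
  rw [Real.sqrt_zero] at t1 t2 t4
  have := t1.add (t4.add ((hε.const_mul (5 / 4)).add ((t2.mul_const (Real.sqrt (ℓ ^ 2 * m2))).const_mul (1 / 2))))
  simpa [Function.comp_def] using this

section
variable {V Vdot : ℝ → ℝ} (hV : Measurable V) (hVdot : Measurable Vdot)
    (hVint : Integrable (fun y => Real.exp (-V y)))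
    {p C β : ℝ} (hp : 4 < p) (hC : 0 < C) (hβ : 1 < β)
    (hH1i : ∀ θ : ℝ,
      Integrable (fun x => |V (x + θ) - V x - θ * Vdot x| ^ p) (piMeasure V) ∧
      (∫ x, |V (x + θ) - V x - θ * Vdot x| ^ p ∂(piMeasure V)) ^ (1 / p) ≤ C * |θ| ^ β)
    (hH1ii : Integrable (fun x => |Vdot x| ^ (6 : ℝ)) (piMeasure V))
    {ℓ : ℝ} (hℓ : 0 < ℓ)

def DF (V Vdot : ℝ → ℝ) (ℓ : ℝ) (d : ℕ) (w : (Fin (d + 1) → ℝ) × (Fin (d + 1) → ℝ)) : ℝ :=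
  |min 1 (Real.exp (∑ i, dV V ℓ (d + 1) (w.1 i) (w.2 i))) -
              min 1 (Real.exp (-(ℓ * w.2 0 / Real.sqrt (d + 1)) * Vdot (w.1 0) +
                ∑ i ∈ Finset.univ.erase (0 : Fin (d + 1)),
                  bFun V Vdot ℓ (d + 1) (w.1 i) (w.2 i)))|

include hV hVdot in
lemma DF_meas (d : ℕ) : Measurable (DF V Vdot ℓ d) := by
  unfold DF dV bFun
  fun_prop

include hV hVdot hVint hp hC hβ hH1i hH1ii hℓ

lemma DF_bound (d : ℕ) (ε : ℝ)
    (hphi : Integrable (fun q : ℝ × ℝ => phiF V Vdot (ℓ * q.2 / Real.sqrt ((d + 1 : ℕ) : ℝ)) q.1)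
      ((piMeasure V).prod (gaussianReal 0 1)))
    (hI : ∫ q : ℝ × ℝ, phiF V Vdot (ℓ * q.2 / Real.sqrt ((d + 1 : ℕ) : ℝ)) q.1
      ∂((piMeasure V).prod (gaussianReal 0 1)) ≤ ε) :
    ∫ w, DF V Vdot ℓ d w ∂(prodPi V (d + 1)) ≤
      bnd ℓ ((∫ x, Vdot x ^ 4 ∂(piMeasure V)) * ∫ z : ℝ, (z ^ 2 - 1) ^ 2 ∂(gaussianReal 0 1))
        (∫ x, Vdot x ^ 2 ∂(piMeasure V)) ((d + 1 : ℕ) : ℝ) ε := by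
  have := piMeasure_prob hVint
  obtain ⟨M, N, hM, hM0, hN, hMN, hMb, hNb⟩ :=
    one_dim hV hVdot hVint hp hC hβ hH1i hH1ii hℓ (d + 1) (by omega) ε hphi hI
  set P := (piMeasure V).prod (gaussianReal 0 1) with hP
  set μ := Measure.pi fun _ : Fin (d + 1) => P with hμ
  obtain ⟨hSi, hSb⟩ := sum_bound P (d + 1) M N hM hM0 hN (Finset.univ.erase 0)
  have hmp := measurePreserving_arrowProdEquivProdArrow ℝ ℝ (Fin (d + 1))
    (fun _ => piMeasure V) (fun _ => gaussianReal 0 1)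
  have hcv : ∫ w, DF V Vdot ℓ d w ∂(prodPi V (d + 1)) =
      ∫ w, DF V Vdot ℓ d (fun i => (w i).1, fun i => (w i).2) ∂μ :=
    (hmp.integral_comp' (DF V Vdot ℓ d)).symm
  -- the remainder at coordinate 0
  set r : ℝ × ℝ → ℝ := fun q => rF V Vdot (ℓ * q.2 / Real.sqrt ((d + 1 : ℕ) : ℝ)) q.1 with hr
  have hrm : Measurable r := by simp only [hr]; unfold rF; fun_prop
  have hr2i : Integrable (fun q => r q ^ 2) P := by
    refine hphi.mono' (by fun_prop) (Filter.Eventually.of_forall fun q => ?_)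
    rw [Real.norm_of_nonneg (sq_nonneg _)]
    unfold phiF
    exact le_add_of_nonneg_left (by positivity)
  have hr2 : MemLp r 2 P := (memLp_two_iff_integrable_sq hrm.aestronglyMeasurable).mpr hr2i
  have hrε : ∫ q, |r q| ∂P ≤ Real.sqrt ε := by
    refine (abs_le_sqrt_sq hr2).trans (Real.sqrt_le_sqrt ?_)
    refine le_trans (integral_mono hr2i hphi fun q => ?_) hI
    unfold phiF
    exact le_add_of_nonneg_left (by positivity)
  have hev : MeasurePreserving (Function.eval (0 : Fin (d + 1))) μ P :=
    measurePreserving_eval (fun _ => P) 0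
  have hri : Integrable (fun q => |r q|) P := (hr2.integrable (by norm_num)).abs
  have hri0 : Integrable (fun w : Fin (d + 1) → ℝ × ℝ => |r (w 0)|) μ :=
    hev.integrable_comp_of_integrable hri
  have hr0 : ∫ w : Fin (d + 1) → ℝ × ℝ, |r (w 0)| ∂μ = ∫ q, |r q| ∂P := by
    have := integral_map hev.measurable.aemeasurable (f := fun q => |r q|)
      (by rw [hev.map_eq]; exact hri.1)
    rw [hev.map_eq] at this
    exact this.symm
  have hpt : ∀ w : Fin (d + 1) → ℝ × ℝ, DF V Vdot ℓ d (fun i => (w i).1, fun i => (w i).2) ≤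
      |r (w 0)| + |∑ i ∈ Finset.univ.erase 0, (M (w i) + N (w i))| := by
    intro w
    unfold DF
    refine (min_exp_le _ _).trans ?_
    have : (∑ i, dV V ℓ (d + 1) (w i).1 (w i).2) -
        (-(ℓ * (w 0).2 / Real.sqrt (d + 1)) * Vdot (w 0).1 +
          ∑ i ∈ Finset.univ.erase (0 : Fin (d + 1)), bFun V Vdot ℓ (d + 1) (w i).1 (w i).2)
        = -r (w 0) + ∑ i ∈ Finset.univ.erase 0, (M (w i) + N (w i)) := by
      rw [← Finset.add_sum_erase _ _ (Finset.mem_univ (0 : Fin (d + 1)))]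
      simp only [← hMN, Finset.sum_sub_distrib]
      simp only [hr, rF, dV]
      push_cast
      ring
    simp only
    rw [this]
    refine (abs_add_le _ _).trans ?_
    rw [abs_neg]
  rw [hcv]
  calc _ ≤ ∫ w : Fin (d + 1) → ℝ × ℝ,
        (|r (w 0)| + |∑ i ∈ Finset.univ.erase 0, (M (w i) + N (w i))|) ∂μ := by
        apply integral_mono_of_nonneg (Filter.Eventually.of_forall fun w => abs_nonneg _)
          (hri0.add hSi.abs) (Filter.Eventually.of_forall hpt)
    _ = (∫ q, |r q| ∂P) + ∫ w : Fin (d + 1) → ℝ × ℝ,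
        |∑ i ∈ Finset.univ.erase 0, (M (w i) + N (w i))| ∂μ := by
        rw [integral_add hri0 hSi.abs, hr0]
    _ ≤ _ := by
        unfold bnd
        refine add_le_add hrε (hSb.trans (add_le_add (Real.sqrt_le_sqrt ?_) ?_))
        · exact mul_le_mul_of_nonneg_left hMb (by positivity)
        · exact mul_le_mul_of_nonneg_left hNb (by positivity)

lemma final_aux (q : ℕ) :
      Tendsto (fun d : ℕ => ∫ w : (Fin (d + 1) → ℝ) × (Fin (d + 1) → ℝ),
          (w.2 0) ^ q * DF V Vdot ℓ d w ∂(prodPi V (d + 1))) atTop (𝓝 0) := by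
  have := piMeasure_prob hVint
  obtain ⟨κ, hκ, hphi⟩ := phi_prod hV hVdot hVint hp hC hβ hH1i hH1ii hℓ
  have ha : 2 < min (2 * β) 3 := lt_min (by linarith) (by norm_num)
  have hb := bnd_tendsto ℓ
    ((∫ x, Vdot x ^ 4 ∂(piMeasure V)) * ∫ z : ℝ, (z ^ 2 - 1) ^ 2 ∂(gaussianReal 0 1))
    (∫ x, Vdot x ^ 2 ∂(piMeasure V)) (integral_nonneg fun _ => sq_nonneg _)
    (fun d => (1 / Real.sqrt ((d + 1 : ℕ) : ℝ)) ^ (min (2 * β) 3) * κ)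
    (fun d => by positivity) (eps_tendsto κ _ ha)
  have hlim := ((Real.continuous_sqrt.tendsto 0).comp hb).const_mul
    (Real.sqrt (∫ z : ℝ, (z ^ q) ^ 2 ∂(gaussianReal 0 1)))
  rw [Real.sqrt_zero, mul_zero] at hlim
  refine squeeze_zero_norm (fun d => ?_) hlim
  have hprob : IsProbabilityMeasure (prodPi V (d + 1)) := by unfold prodPi; infer_instance
  have hDm : Measurable (DF V Vdot ℓ d) := DF_meas hV hVdot d
  have hD1 : ∀ w, DF V Vdot ℓ d w ≤ 1 := fun w => min_exp_le_one _ _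
  have hD0 : ∀ w, 0 ≤ DF V Vdot ℓ d w := fun w => abs_nonneg _
  have hDL : MemLp (DF V Vdot ℓ d) 2 (prodPi V (d + 1)) := by
    refine MemLp.of_bound hDm.aestronglyMeasurable 1 (Filter.Eventually.of_forall fun w => ?_)
    rw [Real.norm_of_nonneg (hD0 w)]; exact hD1 w
  have hev : MeasurePreserving (fun w : (Fin (d + 1) → ℝ) × (Fin (d + 1) → ℝ) => w.2 0)
      (prodPi V (d + 1)) (gaussianReal 0 1) :=
    (measurePreserving_eval (fun _ : Fin (d + 1) => gaussianReal 0 1) 0).comp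
      measurePreserving_snd
  have hzq : MemLp (fun z : ℝ => z ^ q) 2 (gaussianReal 0 1) := by
    rw [memLp_two_iff_integrable_sq (by fun_prop)]
    simp only [← pow_mul]
    exact gauss_pow _
  have hZ : MemLp (fun w : (Fin (d + 1) → ℝ) × (Fin (d + 1) → ℝ) => (w.2 0) ^ q) 2
      (prodPi V (d + 1)) := hzq.comp_measurePreserving hev
  have hZv : ∫ w : (Fin (d + 1) → ℝ) × (Fin (d + 1) → ℝ), ((w.2 0) ^ q) ^ 2 ∂(prodPi V (d + 1))
      = ∫ z : ℝ, (z ^ q) ^ 2 ∂(gaussianReal 0 1) := by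
    have := integral_map hev.measurable.aemeasurable (μ := prodPi V (d + 1)) (f := fun z : ℝ => (z ^ q) ^ 2)
      (by fun_prop)
    rw [hev.map_eq] at this
    exact this.symm
  have hcs := cs_sqrt hZ hDL
  rw [hZv] at hcs
  refine (norm_integral_le_integral_norm _).trans (hcs.trans ?_)
  refine mul_le_mul_of_nonneg_left (Real.sqrt_le_sqrt ?_) (Real.sqrt_nonneg _)
  refine le_trans (integral_mono hDL.integrable_sq (hDL.integrable (by norm_num)) fun w => ?_)
    (DF_bound hV hVdot hVint hp hC hβ hH1i hH1ii hℓ d _ (hphi (d + 1) (by omega)).1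
      (hphi (d + 1) (by omega)).2)
  simp only
  nlinarith [hD0 w, hD1 w]

end

/-- Proposition 1: for every `q ≥ 0`,
`lim_d E[(Z₁^d)^q |1 ∧ exp(∑_{i=1}^d ΔV_i^d) - 1 ∧ exp(υ^d)|] = 0`
(stated with dimension `d+1`, first coordinate `0`). -/
theorem stmt_6
    (V Vdot : ℝ → ℝ) (hV : Measurable V) (hVdot : Measurable Vdot)
    (hVint : Integrable (fun y => Real.exp (-V y)))
    (p C β : ℝ) (hp : 4 < p) (hC : 0 < C) (hβ : 1 < β)
    (hH1i : ∀ θ : ℝ,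
      Integrable (fun x => |V (x + θ) - V x - θ * Vdot x| ^ p) (piMeasure V) ∧
      (∫ x, |V (x + θ) - V x - θ * Vdot x| ^ p ∂(piMeasure V)) ^ (1 / p) ≤ C * |θ| ^ β)
    (hH1ii : Integrable (fun x => |Vdot x| ^ (6 : ℝ)) (piMeasure V))
    (ℓ : ℝ) (hℓ : 0 < ℓ) :
    ∀ q : ℕ,
      Tendsto (fun d : ℕ =>
        ∫ w : (Fin (d + 1) → ℝ) × (Fin (d + 1) → ℝ),
          (w.2 0) ^ q *
            |min 1 (Real.exp (∑ i, dV V ℓ (d + 1) (w.1 i) (w.2 i))) -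
              min 1 (Real.exp (-(ℓ * w.2 0 / Real.sqrt (d + 1)) * Vdot (w.1 0) +
                ∑ i ∈ Finset.univ.erase (0 : Fin (d + 1)),
                  bFun V Vdot ℓ (d + 1) (w.1 i) (w.2 i)))|
          ∂(prodPi V (d + 1)))
        atTop (𝓝 0) := by
  intro q
  exact final_aux hV hVdot hVint hp hC hβ hH1i hH1ii hℓ q
end
end

section
/- Assume H1. For each d let X^d have density π^d(x) = ∏_{i=1}^d π(x_i) and Z^d be an independent standard d-dimensional Gaussian vector. Then the limiting mean acceptance probability of the Random Walk Metropolis algorithm satisfies lim_{d→∞} E[ min(1, ∏_{i=1}^d π(X_i^d + ℓ d^{−1/2} Z_i^d)/π(X_i^d)) ] = 2 Φ(−ℓ √I / 2), where Φ is the standard normal cumulative distribution function and I = ∫ V̇(x)² π(x) dx. -/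
open MeasureTheory ProbabilityTheory Filter Real
open scoped ENNReal NNReal Topology

noncomputable section

lemma core_pointwise (s x D Y : ℝ) (hs : 0 < s) (hD : D = s * x - Y) (K : ℝ) (hK : 0 ≤ K)
    (R r0 : ℂ) (h1 : ‖R - r0 * (x:ℂ)^2‖ ≤ K * x^2) (h2 : ‖R - r0 * (x:ℂ)^2‖ ≤ K * |x|^3) :
    ‖(s:ℂ)^2 * R - r0 * (Y:ℂ)^2‖ ≤
      K * (2 * D^2 + 2 * (s⁻¹ * (2 * Y^4 + D^2 + Y^2))) + ‖r0‖ * (D^2 + 2 * (|D| * |Y|)) := by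
  have e : (s:ℂ)^2 * R - r0 * (Y:ℂ)^2 = (s:ℂ)^2 * (R - r0 * (x:ℂ)^2)
      + r0 * ((s^2 * x^2 - Y^2 : ℝ) : ℂ) := by push_cast; ring
  rw [e]
  refine (norm_add_le _ _).trans (add_le_add ?_ ?_)
  · rw [norm_mul, norm_pow, Complex.norm_real, Real.norm_of_nonneg hs.le]
    have hx : s * x = D + Y := by rw [hD]; ring
    have hYx : Y^2 * |x| ≤ s⁻¹ * (2 * Y^4 + D^2 + Y^2) := by
      have : |x| = s⁻¹ * |D + Y| := by
        rw [← hx, abs_mul, abs_of_pos hs]; field_simp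
      rw [this]
      have h3 : Y^2 * |D+Y| ≤ 2 * Y^4 + D^2 + Y^2 := by
        have := abs_add_le D Y
        have a1 : Y^2 * |D+Y| ≤ Y^2 * (|D| + |Y|) := by gcongr
        have a2 := sq_abs D
        have a3 := sq_abs Y
        nlinarith [sq_nonneg (Y^2 - |D|), sq_nonneg (Y^2 - |Y|), sq_nonneg D, sq_nonneg Y, sq_nonneg (Y^2)]
      calc Y^2 * (s⁻¹ * |D+Y|) = s⁻¹ * (Y^2 * |D+Y|) := by ring
        _ ≤ _ := by gcongr
    have hmain : s^2 * ‖R - r0 * (x:ℂ)^2‖ ≤ K * (2 * D^2 + 2 * (Y^2 * |x|)) := by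
      have hsx : s^2 * x^2 ≤ 2 * D^2 + 2 * Y^2 := by
        have : s^2 * x^2 = (D+Y)^2 := by rw [← hx]; ring
        rw [this]; nlinarith [sq_nonneg (D - Y)]
      rcases le_total |x| 1 with h | h
      · calc s^2 * ‖R - r0 * (x:ℂ)^2‖ ≤ s^2 * (K * |x|^3) := by gcongr
          _ = K * ((s^2 * x^2) * |x|) := by rw [← sq_abs x]; ring
          _ ≤ K * ((2 * D^2 + 2 * Y^2) * |x|) := by gcongr
          _ ≤ _ := by
            have : D^2 * |x| ≤ D^2 := mul_le_of_le_one_right (sq_nonneg _) h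
            gcongr; linarith
      · calc s^2 * ‖R - r0 * (x:ℂ)^2‖ ≤ s^2 * (K * x^2) := by gcongr
          _ = K * (s^2 * x^2) := by ring
          _ ≤ K * (2 * D^2 + 2 * Y^2) := by gcongr
          _ ≤ _ := by
            have : Y^2 ≤ Y^2 * |x| := le_mul_of_one_le_right (sq_nonneg _) h
            gcongr
    refine hmain.trans ?_
    gcongr
  · rw [norm_mul, Complex.norm_real]
    gcongr
    have : s^2 * x^2 - Y^2 = D^2 + 2 * (D * Y) := by rw [hD]; ring
    rw [this, Real.norm_eq_abs]
    refine (abs_add_le _ _).trans ?_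
    rw [abs_mul, abs_mul, abs_of_nonneg (sq_nonneg D)]; norm_num

lemma core_limit {Ω : Type*} [MeasurableSpace Ω] (P : Measure Ω) [IsProbabilityMeasure P]
    (X : ℕ → Ω → ℝ) (Y : Ω → ℝ) (hX : ∀ d, Measurable (X d)) (hY : Measurable Y)
    (hY4 : Integrable (fun ω => Y ω ^ 4) P)
    (hD : ∀ᶠ d : ℕ in atTop, Integrable (fun ω => (√d * X d ω - Y ω)^2) P)
    (hD0 : Tendsto (fun d : ℕ => ∫ ω, (√d * X d ω - Y ω)^2 ∂P) atTop (𝓝 0))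
    (R : ℝ → ℂ) (hR : Measurable R) (r0 : ℂ) (K : ℝ) (hK : 0 ≤ K)
    (h1 : ∀ x, ‖R x - r0 * (x:ℂ)^2‖ ≤ K * x^2) (h2 : ∀ x, ‖R x - r0 * (x:ℂ)^2‖ ≤ K * |x|^3) :
    Tendsto (fun d : ℕ => (d:ℂ) * ∫ ω, R (X d ω) ∂P) atTop
      (𝓝 (r0 * ((∫ ω, Y ω^2 ∂P : ℝ) : ℂ))) := by
  have hY2 : Integrable (fun ω => Y ω ^ 2) P := by
    refine Integrable.mono' ((integrable_const (1:ℝ)).add hY4) (by fun_prop) (ae_of_all _ fun ω => ?_)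
    simp only [Pi.add_apply, norm_pow, Real.norm_eq_abs, sq_abs]
    nlinarith [sq_nonneg (Y ω ^ 2 - 1)]
  rw [tendsto_iff_norm_sub_tendsto_zero]
  set δ : ℕ → ℝ := fun d => ∫ ω, (√d * X d ω - Y ω)^2 ∂P with hδ
  have hlim : Tendsto (fun d : ℕ => K * (2 * δ d + 2 * ((√d)⁻¹ * (2 * (∫ ω, Y ω^4 ∂P) + δ d + ∫ ω, Y ω^2 ∂P)))
      + ‖r0‖ * (δ d + 2 * (√(δ d) * √(∫ ω, Y ω^2 ∂P)))) atTop (𝓝 0) := by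
    have hs : Tendsto (fun d : ℕ => (√d)⁻¹) atTop (𝓝 0) :=
      tendsto_inv_atTop_zero.comp (tendsto_sqrt_atTop.comp tendsto_natCast_atTop_atTop)
    have hsq : Tendsto (fun d => √(δ d)) atTop (𝓝 0) := by
      simpa using hD0.sqrt
    have := (((hD0.const_mul 2).add ((hs.mul ((hD0.const_add (2 * (∫ ω, Y ω^4 ∂P))).add_const
      (∫ ω, Y ω^2 ∂P))).const_mul 2)).const_mul K).add
      ((hD0.add ((hsq.mul_const (√(∫ ω, Y ω^2 ∂P))).const_mul 2)).const_mul ‖r0‖)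
    simpa using this
  refine squeeze_zero' (Eventually.of_forall fun _ => norm_nonneg _) ?_ hlim
  filter_upwards [hD, eventually_gt_atTop 0] with d hd hd0
  have hs : 0 < √(d:ℝ) := Real.sqrt_pos.2 (by exact_mod_cast hd0)
  set s := √(d:ℝ) with hsdef
  have hds : (d:ℂ) = (s:ℂ)^2 := by
    rw [← Complex.ofReal_pow, hsdef, Real.sq_sqrt (by positivity)]; simp
  have hXm := hX d
  have hX2 : Integrable (fun ω => X d ω ^ 2) P := by
    refine Integrable.mono' (((hd.add hY2).const_mul 2).const_mul (s^2)⁻¹) (by fun_prop) (ae_of_all _ fun ω => ?_)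
    simp only [Pi.add_apply, norm_pow, Real.norm_eq_abs, sq_abs]
    rw [le_inv_mul_iff₀ (by positivity)]
    nlinarith [sq_nonneg (s * X d ω - Y ω - Y ω)]
  have hRi : Integrable (fun ω => R (X d ω)) P := by
    refine Integrable.mono' (hX2.const_mul (K + ‖r0‖)) (hR.comp hXm).aestronglyMeasurable (ae_of_all _ fun ω => ?_)
    have := h1 (X d ω)
    have e : R (X d ω) = (R (X d ω) - r0 * (X d ω:ℂ)^2) + r0 * (X d ω:ℂ)^2 := by ring
    rw [e]
    refine (norm_add_le _ _).trans ?_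
    rw [norm_mul, norm_pow, Complex.norm_real, Real.norm_eq_abs, sq_abs]
    linarith
  have hDY : Integrable (fun ω => |s * X d ω - Y ω| * |Y ω|) P := by
    refine Integrable.mono' (hd.add hY2) (by fun_prop) (ae_of_all _ fun ω => ?_)
    simp only [Pi.add_apply, norm_mul, Real.norm_eq_abs, abs_abs]
    have a := sq_abs (s * X d ω - Y ω)
    have b := sq_abs (Y ω)
    nlinarith [sq_nonneg (|s * X d ω - Y ω| - |Y ω|), sq_nonneg (|s * X d ω - Y ω|), sq_nonneg (|Y ω|)]
  have hCS : ∫ ω, |s * X d ω - Y ω| * |Y ω| ∂P ≤ √(δ d) * √(∫ ω, Y ω^2 ∂P) := by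
    have := integral_mul_le_Lp_mul_Lq_of_nonneg (μ := P) Real.HolderConjugate.two_two
      (f := fun ω => |s * X d ω - Y ω|) (g := fun ω => |Y ω|)
      (ae_of_all _ fun _ => abs_nonneg _) (ae_of_all _ fun _ => abs_nonneg _)
      (by
        rw [show ENNReal.ofReal 2 = 2 by simp, memLp_two_iff_integrable_sq (by fun_prop)]
        simpa [sq_abs] using hd)
      (by
        rw [show ENNReal.ofReal 2 = 2 by simp, memLp_two_iff_integrable_sq (by fun_prop)]
        simpa [sq_abs] using hY2)
    simpa [Real.sqrt_eq_rpow, hδ, hsdef] using this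
  have hc : (d:ℂ) * (∫ ω, R (X d ω) ∂P) - r0 * ((∫ ω, Y ω^2 ∂P : ℝ) : ℂ)
      = ∫ ω, ((s:ℂ)^2 * R (X d ω) - r0 * (Y ω:ℂ)^2) ∂P := by
    rw [integral_sub (hRi.const_mul _), integral_const_mul, integral_const_mul, hds,
      ← integral_complex_ofReal]
    · simp
    · have := (hY2.ofReal (𝕜 := ℂ)).const_mul r0
      simpa using this
  rw [hc]
  refine (norm_integral_le_of_norm_le (g := fun ω => K * (2 * (s * X d ω - Y ω)^2 + 2 * (s⁻¹ * (2 * Y ω^4 + (s * X d ω - Y ω)^2 + Y ω^2))) + ‖r0‖ * ((s * X d ω - Y ω)^2 + 2 * (|s * X d ω - Y ω| * |Y ω|)))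
    ?_ (ae_of_all _ fun ω => core_pointwise s (X d ω) _ (Y ω) hs rfl K hK _ r0 (h1 _) (h2 _))).trans ?_
  · exact (((hd.const_mul 2).add (((((hY4.const_mul 2).add hd).add hY2).const_mul s⁻¹).const_mul 2)).const_mul K).add
      ((hd.add (hDY.const_mul 2)).const_mul ‖r0‖)
  · rw [integral_add, integral_const_mul, integral_add, integral_const_mul, integral_const_mul,
      integral_const_mul, integral_add, integral_add, integral_const_mul, integral_const_mul,
      integral_add, integral_const_mul]
    · gcongr
    all_goals first
      | exact hd | exact hY2 | exact hY4.const_mul 2 | exact hd.const_mul 2 | exact hDY.const_mul 2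
      | exact (hY4.const_mul 2).add hd
      | exact ((((hY4.const_mul 2).add hd).add hY2).const_mul s⁻¹).const_mul 2
      | exact ((hd.const_mul 2).add (((((hY4.const_mul 2).add hd).add hY2).const_mul s⁻¹).const_mul 2)).const_mul K
      | exact (hd.add (hDY.const_mul 2)).const_mul ‖r0‖

/-- truncated odd function times exp -/
def GG (x : ℝ) : ℝ := Real.exp (x/2) * (if |x| ≤ 1 then x else 0)

lemma measurable_GG : Measurable GG := by
  unfold GG
  refine Measurable.mul (by fun_prop) (Measurable.ite ?_ measurable_id measurable_const)
  exact measurableSet_le (by fun_prop) (by fun_prop)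

lemma GG_bound (x : ℝ) : |GG x| ≤ 2 := by
  unfold GG
  split_ifs with h
  · rw [abs_mul, abs_of_pos (Real.exp_pos _)]
    have : Real.exp (x/2) ≤ 2 := by
      have h1 : Real.exp (x/2) ≤ Real.exp (1/2) := by
        apply Real.exp_le_exp.2; linarith [le_abs_self x]
      have h2 : Real.exp (1/2) * Real.exp (1/2) = Real.exp 1 := by rw [← Real.exp_add]; norm_num
      have := Real.exp_one_lt_d9
      nlinarith [Real.exp_pos (1/2)]
    nlinarith [abs_nonneg x, Real.exp_pos (x/2)]
  · simp

def RR (t x : ℝ) : ℂ := Complex.exp (t * x * Complex.I) - 1 - t * Complex.I * (GG x : ℂ)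

lemma measurable_RR (t : ℝ) : Measurable (RR t) := by
  have := measurable_GG
  unfold RR
  fun_prop

lemma RR_bound (t : ℝ) : ∃ K : ℝ, 0 ≤ K ∧ ∀ x : ℝ,
    ‖RR t x - (-(t:ℂ)^2/2 - t * Complex.I/2) * (x:ℂ)^2‖ ≤ K * x^2 ∧
    ‖RR t x - (-(t:ℂ)^2/2 - t * Complex.I/2) * (x:ℂ)^2‖ ≤ K * |x|^3 := by
  set r0 : ℂ := (-(t:ℂ)^2/2 - t * Complex.I/2) with hr0
  have hA : ∀ x : ℝ, |x| ≤ 1 → ‖RR t x - r0 * (x:ℂ)^2‖ ≤ (|t|^3 * Real.exp |t| + |t|) * |x|^3 := by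
    intro x hx
    have e : RR t x - r0 * (x:ℂ)^2 =
      (Complex.exp (t * x * Complex.I) - ∑ m ∈ Finset.range 3, (t * x * Complex.I)^m / (m.factorial : ℂ))
        - t * Complex.I * x * ((Real.exp (x/2) - 1 - x/2 : ℝ) : ℂ) := by
      simp only [RR, GG, if_pos hx, hr0, Finset.sum_range_succ, Finset.sum_range_zero, Nat.factorial]
      push_cast
      linear_combination ((t:ℂ)^2 * x^2 / 2) * Complex.I_sq
    rw [e]
    refine (norm_sub_le _ _).trans ?_
    have n1 : ‖(t * x * Complex.I : ℂ)‖ = |t| * |x| := by simp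
    have b1 := Complex.norm_exp_sub_sum_le_norm_mul_exp (t * x * Complex.I) 3
    rw [n1] at b1
    have b2 : |Real.exp (x/2) - 1 - x/2| ≤ x^2 := by
      have := Real.abs_exp_sub_one_sub_id_le (x := x/2) (by rw [abs_div]; norm_num; linarith)
      refine this.trans ?_
      nlinarith [sq_nonneg x]
    rw [norm_mul, Complex.norm_real, Real.norm_eq_abs]
    have n2 : ‖(t * Complex.I * x : ℂ)‖ = |t| * |x| := by simp
    rw [n2, add_mul]
    refine add_le_add (b1.trans ?_) ?_
    · have : |t| * |x| ≤ |t| := mul_le_of_le_one_right (abs_nonneg _) hx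
      calc (|t| * |x|)^3 * Real.exp (|t| * |x|) ≤ (|t| * |x|)^3 * Real.exp |t| := by gcongr
        _ = _ := by ring
    · calc |t| * |x| * |Real.exp (x/2) - 1 - x/2| ≤ |t| * |x| * x^2 := by gcongr
        _ = _ := by rw [← sq_abs x]; ring
  have hB : ∀ x : ℝ, 1 ≤ |x| → ‖RR t x - r0 * (x:ℂ)^2‖ ≤ (2 + 2 * |t| + ‖r0‖) * x^2 := by
    intro x hx
    have hx2 : 1 ≤ x^2 := by rw [← sq_abs]; nlinarith
    have n1 : ‖RR t x‖ ≤ 2 + 2 * |t| := by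
      unfold RR
      refine (norm_sub_le _ _).trans (add_le_add ((norm_sub_le _ _).trans ?_) ?_)
      · have := Complex.norm_exp_ofReal_mul_I (t * x)
        push_cast at this
        rw [this]; norm_num
      · have := GG_bound x
        simp only [norm_mul, Complex.norm_real, Complex.norm_I, Real.norm_eq_abs]
        nlinarith [abs_nonneg t]
    refine (norm_sub_le _ _).trans ?_
    rw [norm_mul, norm_pow, Complex.norm_real, Real.norm_eq_abs, sq_abs]
    nlinarith [abs_nonneg t]
  refine ⟨(|t|^3 * Real.exp |t| + |t|) + (2 + 2 * |t| + ‖r0‖), by positivity, fun x => ?_⟩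
  have p1 : 0 ≤ |t|^3 * Real.exp |t| + |t| := by positivity
  have p2 : 0 ≤ 2 + 2 * |t| + ‖r0‖ := by positivity
  have e3 : |x|^3 = |x| * x^2 := by rw [← sq_abs x]; ring
  rcases le_total |x| 1 with h | h
  · have := hA x h
    have l : |x|^3 ≤ x^2 := by rw [e3]; exact mul_le_of_le_one_left (sq_nonneg _) h
    have p3 : 0 ≤ |x|^3 := by positivity
    constructor <;> nlinarith
  · have := hB x h
    have l : x^2 ≤ |x|^3 := by rw [e3]; exact le_mul_of_one_le_left (sq_nonneg _) h
    have p3 : 0 ≤ x^2 := by positivity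
    constructor <;> nlinarith

lemma integral_min_exp_gaussian (s : ℝ) (hs : 0 ≤ s) :
    ∫ w, min 1 (Real.exp w) ∂(gaussianReal (-(s^2)/2) (s^2).toNNReal) = 2 * stdGaussCDF (-s/2) := by
  rcases hs.eq_or_lt with rfl | hs
  · have hmap : gaussianReal 0 1 (Set.Iic 0) = gaussianReal 0 1 (Set.Ici 0) := by
      have := gaussianReal_map_neg (μ := 0) (v := 1)
      rw [neg_zero] at this
      nth_rw 1 [← this]
      rw [Measure.map_apply (by fun_prop) measurableSet_Iic]
      congr 1; ext; simp
    have : NullSingletonClass (gaussianReal 0 1) := nullSingletonClass_gaussianReal (by norm_num)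
    have h2 : (gaussianReal 0 1).real (Set.Iic 0) + (gaussianReal 0 1).real (Set.Ioi 0) = 1 := by
      rw [← measureReal_union (by simp) measurableSet_Ioi]; simp
    have h3 : gaussianReal 0 1 (Set.Ici 0) = gaussianReal 0 1 (Set.Ioi 0) := measure_congr Ioi_ae_eq_Ici.symm
    have h4 : (gaussianReal 0 1).real (Set.Ioi 0) = (gaussianReal 0 1).real (Set.Iic 0) := by
      simp only [Measure.real, hmap, h3]
    simp [stdGaussCDF, ← Measure.real_def]
    linarith
  · have hv : (s^2).toNNReal ≠ 0 := by simp; positivity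
    have hvr : (((s^2).toNNReal : ℝ≥0) : ℝ) = s^2 := Real.coe_toNNReal _ (by positivity)
    set v := (s^2).toNNReal with hvdef
    have hg : Integrable (fun w => min 1 (Real.exp w)) (gaussianReal (-(s^2)/2) v) := by
      refine Integrable.mono' (integrable_const (1:ℝ)) (by fun_prop) (ae_of_all _ fun w => ?_)
      rw [Real.norm_of_nonneg (by positivity)]; exact min_le_left _ _
    -- the law as affine image
    have hm : ∀ m : ℝ, gaussianReal m v = (gaussianReal 0 1).map (fun x => s * x + m) := by
      intro m
      have := gaussianReal_map_const_mul (μ := 0) (v := 1) s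
      rw [show (fun x => s * x + m) = (fun x => x + m) ∘ (fun x => s * x) from rfl,
        ← Measure.map_map (by fun_prop) (by fun_prop), this, gaussianReal_map_add_const]
      congr 1
      · simp
      · ext; simp [hvr]
    have hA : (gaussianReal (s^2/2) v).real (Set.Iic 0) = stdGaussCDF (-s/2) := by
      rw [hm, Measure.real, Measure.map_apply (by fun_prop) measurableSet_Iic, stdGaussCDF]
      congr 2
      ext x
      simp only [Set.mem_preimage, Set.mem_Iic]
      constructor
      · intro h; by_contra hc; push Not at hc; nlinarith
      · intro h; nlinarith
    have hB : (gaussianReal (-(s^2)/2) v).real (Set.Ioi 0) = stdGaussCDF (-s/2) := by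
      rw [← hA]
      have := gaussianReal_map_neg (μ := -(s^2)/2) (v := v)
      rw [show -(-(s^2)/2) = s^2/2 by ring] at this
      rw [← this, Measure.real, Measure.real, Measure.map_apply (by fun_prop) measurableSet_Iic]
      have : NullSingletonClass (gaussianReal (-(s^2)/2) v) := nullSingletonClass_gaussianReal hv
      rw [show (fun x : ℝ => -x) ⁻¹' Set.Iic 0 = Set.Ici 0 by ext; simp]
      congr 1
      exact measure_congr Ioi_ae_eq_Ici
    rw [← integral_add_compl (measurableSet_Iic (a := (0:ℝ))) hg, two_mul, Set.compl_Iic]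
    congr 1
    · rw [← hA, setIntegral_congr_fun (g := fun w => Real.exp w) measurableSet_Iic
        (fun w hw => min_eq_right (Real.exp_le_one_iff.2 hw))]
      rw [Measure.real, gaussianReal_apply_eq_integral _ hv,
        ENNReal.toReal_ofReal (integral_nonneg fun x => gaussianPDFReal_nonneg _ _ _),
        ← integral_indicator measurableSet_Iic, integral_gaussianReal_eq_integral_smul hv,
        ← integral_indicator measurableSet_Iic]
      congr 1
      ext w
      by_cases hw : w ∈ Set.Iic 0
      · simp only [Set.indicator_of_mem hw, smul_eq_mul, gaussianPDFReal_def, hvr]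
        rw [mul_assoc, ← Real.exp_add]
        congr 2
        field_simp
        ring
      · simp [Set.indicator_of_notMem hw]
    · rw [← hB, setIntegral_congr_fun (g := fun w => (1:ℝ)) measurableSet_Ioi
        (fun w (hw : 0 < w) => min_eq_left (Real.one_le_exp hw.le))]
      simp

lemma Z_pos (V : ℝ → ℝ) (hVint : Integrable (fun y => Real.exp (-V y))) :
    0 < ∫ y, Real.exp (-V y) := integral_exp_pos hVint

lemma piDen_nonneg (V : ℝ → ℝ) (x : ℝ) : 0 ≤ piDen V x :=
  div_nonneg (Real.exp_pos _).le (integral_nonneg fun _ => (Real.exp_pos _).le)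

lemma measurable_piDen (V : ℝ → ℝ) (hV : Measurable V) : Measurable (piDen V) := by
  unfold piDen; fun_prop

lemma isProb_piMeasure (V : ℝ → ℝ) (hVint : Integrable (fun y => Real.exp (-V y))) :
    IsProbabilityMeasure (piMeasure V) := by
  constructor
  rw [piMeasure, withDensity_apply _ MeasurableSet.univ, Measure.restrict_univ]
  simp only [piDen]
  rw [← ofReal_integral_eq_lintegral_ofReal (hVint.div_const _) (ae_of_all _ fun x => piDen_nonneg V x)]
  rw [integral_div, div_self (Z_pos V hVint).ne', ENNReal.ofReal_one]

lemma integral_piMeasure (V : ℝ → ℝ) (hV : Measurable V) (f : ℝ → ℝ) :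
    ∫ x, f x ∂(piMeasure V) = ∫ x, piDen V x * f x := by
  rw [piMeasure, integral_withDensity_eq_integral_toReal_smul
    (measurable_piDen V hV).ennreal_ofReal (ae_of_all _ fun _ => ENNReal.ofReal_lt_top)]
  simp [ENNReal.toReal_ofReal (piDen_nonneg V _)]

lemma H_odd (V : ℝ → ℝ) (hV : Measurable V) (θ : ℝ) :
    ∫ x, GG (V x - V (x + -θ)) ∂(piMeasure V) = - ∫ x, GG (V x - V (x + θ)) ∂(piMeasure V) := by
  rw [integral_piMeasure V hV, integral_piMeasure V hV, ← integral_neg,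
    ← integral_add_right_eq_self _ θ]
  congr 1
  ext x
  rw [show x + θ + -θ = x by ring]
  unfold GG piDen
  rw [abs_sub_comm (V (x + θ)) (V x)]
  have e : Real.exp (-V (x+θ)) * Real.exp ((V (x+θ) - V x)/2)
      = Real.exp (-V x) * Real.exp ((V x - V (x+θ))/2) := by
    rw [← Real.exp_add, ← Real.exp_add]; congr 1; ring
  split_ifs
  · linear_combination ((∫ y, Real.exp (-V y))⁻¹ * (V (x+θ) - V x)) * e
  · simp

lemma integral_GG (V : ℝ → ℝ) (hV : Measurable V) (hVint : Integrable (fun y => Real.exp (-V y)))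
    (ℓ s : ℝ) :
    ∫ w : ℝ × ℝ, GG (V w.1 - V (w.1 + ℓ * w.2 / s)) ∂((piMeasure V).prod (gaussianReal 0 1)) = 0 := by
  have := isProb_piMeasure V hVint
  have hi : Integrable (fun w : ℝ × ℝ => GG (V w.1 - V (w.1 + ℓ * w.2 / s)))
      ((piMeasure V).prod (gaussianReal 0 1)) := by
    refine Integrable.mono' (integrable_const (2:ℝ)) ?_ (ae_of_all _ fun w => GG_bound _)
    exact (measurable_GG.comp (by fun_prop)).aestronglyMeasurable
  rw [integral_prod_symm _ hi]
  simp only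
  set H : ℝ → ℝ := fun z => ∫ x, GG (V x - V (x + ℓ * z / s)) ∂(piMeasure V) with hH
  have hodd : ∀ z, H (-z) = - H z := by
    intro z
    simp only [hH]
    rw [← H_odd V hV]
    congr 1; ext x; congr 4; ring
  have hmap := gaussianReal_map_neg (μ := 0) (v := 1)
  rw [neg_zero] at hmap
  have h1 : ∫ z, H z ∂(gaussianReal 0 1) = ∫ z, H (-z) ∂(gaussianReal 0 1) := by
    conv_lhs => rw [← hmap]
    exact (MeasurableEquiv.neg ℝ).measurableEmbedding.integral_map H
  simp_rw [hodd] at h1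
  rw [integral_neg] at h1
  linarith

lemma rho_bound (μ : Measure ℝ) [IsProbabilityMeasure μ] (ρ : ℝ → ℝ) (hρ : Measurable ρ)
    (p B : ℝ) (hp : 4 < p) (hi : Integrable (fun x => |ρ x| ^ p) μ)
    (hB : (∫ x, |ρ x| ^ p ∂μ) ^ (1 / p) ≤ B) :
    ∫⁻ x, ENNReal.ofReal (ρ x ^ 2) ∂μ ≤ ENNReal.ofReal (B ^ 2) := by
  have hp0 : 0 < p := by linarith
  have hpe0 : ENNReal.ofReal p ≠ 0 := by simpa using hp0
  have hpr : (ENNReal.ofReal p).toReal = p := ENNReal.toReal_ofReal hp0.le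
  have hm : MemLp ρ (ENNReal.ofReal p) μ := by
    rw [← integrable_norm_rpow_iff hρ.aestronglyMeasurable hpe0 ENNReal.ofReal_ne_top, hpr]
    simpa using hi
  have h1 : eLpNorm ρ (ENNReal.ofReal p) μ ≤ ENNReal.ofReal B := by
    rw [hm.eLpNorm_eq_integral_rpow_norm hpe0 ENNReal.ofReal_ne_top, hpr]
    apply ENNReal.ofReal_le_ofReal
    simpa using hB
  have h2 : eLpNorm ρ 2 μ ≤ eLpNorm ρ (ENNReal.ofReal p) μ := by
    apply eLpNorm_le_eLpNorm_of_exponent_le _ hρ.aestronglyMeasurable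
    rw [show (2:ℝ≥0∞) = ENNReal.ofReal 2 by simp]
    apply ENNReal.ofReal_le_ofReal; linarith
  have h3 : ∫⁻ x, ENNReal.ofReal (ρ x ^ 2) ∂μ = eLpNorm ρ 2 μ ^ 2 := by
    rw [← ENNReal.rpow_natCast, eLpNorm_eq_lintegral_rpow_enorm_toReal (by simp) (by simp), ← ENNReal.rpow_mul]
    simp
    congr 1; ext x
    rw [← sq_abs, ENNReal.ofReal_pow (abs_nonneg _), Real.enorm_eq_ofReal_abs]
  rw [h3]
  have hB0 : 0 ≤ B := le_trans (by positivity) hB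
  rw [ENNReal.ofReal_pow hB0]
  gcongr
  exact h2.trans h1

lemma integrable_gauss_A (C ℓ β : ℝ) (hβ : 1 < β) :
    Integrable (fun z : ℝ => (C * |ℓ * z| ^ β) ^ 2) (gaussianReal 0 1) := by
  have h := memLp_id_gaussianReal' (μ := 0) (v := 1) (ENNReal.ofReal (2 * β)) ENNReal.ofReal_ne_top
  have h2 := h.integrable_norm_rpow (by simp; linarith) ENNReal.ofReal_ne_top
  rw [ENNReal.toReal_ofReal (by linarith)] at h2
  refine (h2.const_mul ((C * |ℓ| ^ β) ^ 2)).congr (ae_of_all _ fun z => ?_)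
  simp only [id, Real.norm_eq_abs]
  rw [abs_mul, Real.mul_rpow (abs_nonneg _) (abs_nonneg _), mul_comm 2 β, Real.rpow_mul (abs_nonneg _)]
  norm_num
  ring

lemma D_bound (V Vdot : ℝ → ℝ) (hV : Measurable V) (hVdot : Measurable Vdot)
    (hVint : Integrable (fun y => Real.exp (-V y)))
    (p C β : ℝ) (hp : 4 < p) (hC : 0 < C) (hβ : 1 < β)
    (hH1i : ∀ θ : ℝ,
      Integrable (fun x => |V (x + θ) - V x - θ * Vdot x| ^ p) (piMeasure V) ∧
      (∫ x, |V (x + θ) - V x - θ * Vdot x| ^ p ∂(piMeasure V)) ^ (1 / p) ≤ C * |θ| ^ β)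
    (ℓ s : ℝ) (hs : 0 < s) :
    Integrable (fun w : ℝ × ℝ => (s * (V w.1 - V (w.1 + ℓ * w.2 / s)) - (-(Vdot w.1 * (ℓ * w.2))))^2)
      ((piMeasure V).prod (gaussianReal 0 1)) ∧
    ∫ w : ℝ × ℝ, (s * (V w.1 - V (w.1 + ℓ * w.2 / s)) - (-(Vdot w.1 * (ℓ * w.2))))^2
      ∂((piMeasure V).prod (gaussianReal 0 1)) ≤
      (s ^ (1 - β)) ^ 2 * ∫ z, (C * |ℓ * z| ^ β) ^ 2 ∂(gaussianReal 0 1) := by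
  have := isProb_piMeasure V hVint
  set F : ℝ × ℝ → ℝ := fun w => (s * (V w.1 - V (w.1 + ℓ * w.2 / s)) - (-(Vdot w.1 * (ℓ * w.2))))^2 with hF
  have hFm : Measurable F := by fun_prop
  have hF0 : ∀ w, 0 ≤ F w := fun w => sq_nonneg _
  have hA := integrable_gauss_A C ℓ β hβ
  have hle : ∫⁻ w, ENNReal.ofReal (F w) ∂((piMeasure V).prod (gaussianReal 0 1)) ≤
      ENNReal.ofReal ((s ^ (1 - β)) ^ 2 * ∫ z, (C * |ℓ * z| ^ β) ^ 2 ∂(gaussianReal 0 1)) := by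
    rw [lintegral_prod_symm _ hFm.ennreal_ofReal.aemeasurable, ← integral_const_mul,
      ofReal_integral_eq_lintegral_ofReal (hA.const_mul _) (ae_of_all _ fun z => by positivity)]
    refine lintegral_mono fun z => ?_
    set θ := ℓ * z / s with hθ
    have hb := rho_bound (piMeasure V) (fun x => V (x + θ) - V x - θ * Vdot x) (by fun_prop) p _ hp
      (hH1i θ).1 (hH1i θ).2
    have e1 : ∀ x, ENNReal.ofReal (F (x, z)) = ENNReal.ofReal (s^2) * ENNReal.ofReal ((V (x + θ) - V x - θ * Vdot x)^2) := by
      intro x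
      rw [← ENNReal.ofReal_mul (by positivity)]
      congr 1
      simp only [hF, ← hθ]
      have : ℓ * z = s * θ := by rw [hθ]; field_simp
      rw [this]; ring
    simp only [e1]
    rw [lintegral_const_mul _ (by fun_prop)]
    calc _ ≤ ENNReal.ofReal (s^2) * ENNReal.ofReal ((C * |θ| ^ β) ^ 2) := by gcongr
      _ = _ := by
        rw [← ENNReal.ofReal_mul (by positivity)]
        congr 1
        rw [hθ, abs_div, abs_of_pos hs, Real.div_rpow (abs_nonneg _) hs.le, Real.rpow_sub hs, Real.rpow_one]
        have : 0 < s ^ β := by positivity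
        field_simp
  have hi : Integrable F ((piMeasure V).prod (gaussianReal 0 1)) := by
    refine ⟨hFm.aestronglyMeasurable, ?_⟩
    rw [hasFiniteIntegral_iff_ofReal (ae_of_all _ hF0)]
    exact hle.trans_lt ENNReal.ofReal_lt_top
  refine ⟨hi, ?_⟩
  rw [← ofReal_integral_eq_lintegral_ofReal hi (ae_of_all _ hF0)] at hle
  refine (ENNReal.ofReal_le_ofReal_iff ?_).1 hle
  positivity

lemma charFun_lim (V Vdot : ℝ → ℝ) (hV : Measurable V) (hVdot : Measurable Vdot)
    (hVint : Integrable (fun y => Real.exp (-V y)))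
    (p C β : ℝ) (hp : 4 < p) (hC : 0 < C) (hβ : 1 < β)
    (hH1i : ∀ θ : ℝ,
      Integrable (fun x => |V (x + θ) - V x - θ * Vdot x| ^ p) (piMeasure V) ∧
      (∫ x, |V (x + θ) - V x - θ * Vdot x| ^ p ∂(piMeasure V)) ^ (1 / p) ≤ C * |θ| ^ β)
    (hH1ii : Integrable (fun x => |Vdot x| ^ (6 : ℝ)) (piMeasure V))
    (ℓ t : ℝ) :
    Tendsto (fun d : ℕ => (∫ w : ℝ × ℝ, Complex.exp (t * (V w.1 - V (w.1 + ℓ * w.2 / √d) : ℝ) * Complex.I)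
        ∂((piMeasure V).prod (gaussianReal 0 1))) ^ d) atTop
      (𝓝 (Complex.exp ((-(t:ℂ)^2/2 - t * Complex.I/2) *
        ((ℓ^2 * ∫ x, (Vdot x)^2 ∂(piMeasure V) : ℝ) : ℂ)))) := by
  have := isProb_piMeasure V hVint
  set P := (piMeasure V).prod (gaussianReal 0 1) with hP
  have hV4 : Integrable (fun x => Vdot x ^ 4) (piMeasure V) := by
    refine Integrable.mono' ((integrable_const (1:ℝ)).add hH1ii) (by fun_prop) (ae_of_all _ fun x => ?_)
    simp only [Pi.add_apply, norm_pow, Real.norm_eq_abs]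
    rw [show (6:ℝ) = ((6:ℕ):ℝ) by norm_num, Real.rpow_natCast]
    rcases le_total |Vdot x| 1 with h | h
    · have := pow_le_one₀ (n := 4) (abs_nonneg _) h
      have : 0 ≤ |Vdot x|^6 := by positivity
      linarith
    · have := pow_le_pow_right₀ h (show 4 ≤ 6 by norm_num)
      linarith
  have hz4 : Integrable (fun z : ℝ => (ℓ * z) ^ 4) (gaussianReal 0 1) := by
    have h := (memLp_id_gaussianReal (μ := 0) (v := 1) 4).integrable_norm_pow (p := 4) (by norm_num)
    refine (h.const_mul (ℓ^4)).congr (ae_of_all _ fun z => ?_)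
    simp only [id, Real.norm_eq_abs, mul_pow]
    rw [Even.pow_abs (by decide)]
  set Y : ℝ × ℝ → ℝ := fun w => -(Vdot w.1 * (ℓ * w.2)) with hY
  have hY4 : Integrable (fun w => Y w ^ 4) P := by
    refine (hV4.mul_prod hz4).congr (ae_of_all _ fun w => ?_)
    simp only [hY]; ring
  have hY2 : ∫ w, Y w ^ 2 ∂P = ℓ^2 * ∫ x, (Vdot x)^2 ∂(piMeasure V) := by
    have e : ∀ w : ℝ × ℝ, Y w ^ 2 = Vdot w.1 ^ 2 * (ℓ^2 * w.2^2) := by intro w; simp only [hY]; ring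
    simp only [e]
    rw [hP, integral_prod_mul (fun x => Vdot x ^ 2) (fun z => ℓ^2 * z^2), integral_const_mul]
    have hv : ∫ z, z^2 ∂(gaussianReal 0 1) = 1 := by
      have := variance_fun_id_gaussianReal (μ := 0) (v := 1)
      rw [variance_of_integral_eq_zero (by fun_prop) (by simp)] at this
      simpa using this
    rw [hv]; ring
  set X : ℕ → ℝ × ℝ → ℝ := fun d w => V w.1 - V (w.1 + ℓ * w.2 / √d) with hX
  have hXm : ∀ d, Measurable (X d) := by intro d; fun_prop
  have hDb := D_bound V Vdot hV hVdot hVint p C β hp hC hβ hH1i ℓ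
  obtain ⟨K, hK, hKb⟩ := RR_bound t
  have hcore := core_limit P X Y hXm (by fun_prop) hY4 ?_ ?_ (RR t) (measurable_RR t) _ K hK
    (fun x => (hKb x).1) (fun x => (hKb x).2)
  · rw [hY2] at hcore
    have := Complex.tendsto_one_add_pow_exp_of_tendsto hcore
    refine this.congr fun d => ?_
    congr 1
    have hGi : Integrable (fun w => (t * Complex.I : ℂ) * (GG (X d w) : ℂ)) P := by
      refine Integrable.const_mul ?_ _
      refine Integrable.ofReal ?_
      refine Integrable.mono' (integrable_const (2:ℝ)) ?_ (ae_of_all _ fun w => GG_bound _)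
      exact (measurable_GG.comp (hXm d)).aestronglyMeasurable
    have hEi : Integrable (fun w => Complex.exp (t * (X d w : ℝ) * Complex.I)) P := by
      refine Integrable.mono' (integrable_const (1:ℝ)) ?_ (ae_of_all _ fun w => ?_)
      · have := hXm d
        exact Measurable.aestronglyMeasurable (by fun_prop)
      · have := Complex.norm_exp_ofReal_mul_I (t * X d w)
        push_cast at this
        exact this.le
    have hG0 : ∫ w, (t * Complex.I : ℂ) * (GG (X d w) : ℂ) ∂P = 0 := by
      rw [integral_const_mul, integral_complex_ofReal, integral_GG V hV hVint ℓ (√d)]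
      simp
    simp only [RR]
    have hE1 : Integrable (fun w => Complex.exp (t * (X d w : ℝ) * Complex.I) - 1) P :=
      hEi.sub (integrable_const _)
    rw [integral_sub hE1 hGi, hG0, integral_sub hEi (integrable_const _)]
    simp [hX]
  · filter_upwards [eventually_gt_atTop 0] with d hd
    exact (hDb (√d) (Real.sqrt_pos.2 (by exact_mod_cast hd))).1
  · have hlim : Tendsto (fun d : ℕ => ((√(d:ℝ)) ^ (1 - β)) ^ 2 * ∫ z, (C * |ℓ * z| ^ β) ^ 2 ∂(gaussianReal 0 1))
        atTop (𝓝 0) := by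
      have h1 : Tendsto (fun d : ℕ => (√(d:ℝ)) ^ (-(β - 1))) atTop (𝓝 0) :=
        (tendsto_rpow_neg_atTop (by linarith)).comp (tendsto_sqrt_atTop.comp tendsto_natCast_atTop_atTop)
      simp only [neg_sub] at h1
      simpa using (h1.pow 2).mul_const (∫ z, (C * |ℓ * z| ^ β) ^ 2 ∂(gaussianReal 0 1))
    refine squeeze_zero' (Eventually.of_forall fun _ => integral_nonneg fun _ => sq_nonneg _) ?_ hlim
    filter_upwards [eventually_gt_atTop 0] with d hd
    exact (hDb (√d) (Real.sqrt_pos.2 (by exact_mod_cast hd))).2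

lemma pi_prod_integral (μ ν : Measure ℝ) [IsProbabilityMeasure μ] [IsProbabilityMeasure ν]
    (d : ℕ) (f : ℝ × ℝ → ℂ) :
    ∫ w : (Fin d → ℝ) × (Fin d → ℝ), ∏ i, f (w.1 i, w.2 i)
      ∂((Measure.pi fun _ : Fin d => μ).prod (Measure.pi fun _ : Fin d => ν))
    = (∫ w, f w ∂(μ.prod ν)) ^ d := by
  have h := measurePreserving_arrowProdEquivProdArrow ℝ ℝ (Fin d) (fun _ => μ) (fun _ => ν)
  rw [← h.integral_comp (MeasurableEquiv.measurableEmbedding _)]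
  have := integral_fintype_prod_eq_pow (ι := Fin d) (μ := μ.prod ν) f
  rw [Fintype.card_fin] at this
  rw [← this]
  rfl

/-- Theorem 2: the mean acceptance probability of the RWM algorithm converges to
`2Φ(-ℓ√I/2)` where `I = ∫ V̇² π`. -/
theorem stmt_7
    (V Vdot : ℝ → ℝ) (hV : Measurable V) (hVdot : Measurable Vdot)
    (hVint : Integrable (fun y => Real.exp (-V y)))
    (p C β : ℝ) (hp : 4 < p) (hC : 0 < C) (hβ : 1 < β)
    (hH1i : ∀ θ : ℝ,
      Integrable (fun x => |V (x + θ) - V x - θ * Vdot x| ^ p) (piMeasure V) ∧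
      (∫ x, |V (x + θ) - V x - θ * Vdot x| ^ p ∂(piMeasure V)) ^ (1 / p) ≤ C * |θ| ^ β)
    (hH1ii : Integrable (fun x => |Vdot x| ^ (6 : ℝ)) (piMeasure V))
    (ℓ : ℝ) (hℓ : 0 < ℓ) :
    Tendsto (fun d : ℕ =>
      ∫ w : (Fin d → ℝ) × (Fin d → ℝ),
        min 1 (∏ i, piDen V (w.1 i + ℓ * w.2 i / Real.sqrt d) / piDen V (w.1 i))
        ∂((Measure.pi fun _ : Fin d => piMeasure V).prod
            (Measure.pi fun _ : Fin d => gaussianReal 0 1)))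
      atTop
      (𝓝 (2 * stdGaussCDF (-(ℓ * Real.sqrt (∫ x, (Vdot x) ^ 2 ∂(piMeasure V))) / 2))) := by
  have := isProb_piMeasure V hVint
  set I := ∫ x, (Vdot x) ^ 2 ∂(piMeasure V) with hI
  have hI0 : 0 ≤ I := integral_nonneg fun _ => sq_nonneg _
  set s := ℓ * √I with hs
  have hs0 : 0 ≤ s := by positivity
  have hs2 : s^2 = ℓ^2 * I := by rw [hs, mul_pow, Real.sq_sqrt hI0]
  set S : (d : ℕ) → (Fin d → ℝ) × (Fin d → ℝ) → ℝ :=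
    fun d w => ∑ i, (V (w.1 i) - V (w.1 i + ℓ * w.2 i / √d)) with hS
  have hSm : ∀ d, Measurable (S d) := by intro d; fun_prop
  set P : (d : ℕ) → Measure ((Fin d → ℝ) × (Fin d → ℝ)) := fun d =>
    (Measure.pi fun _ : Fin d => piMeasure V).prod (Measure.pi fun _ : Fin d => gaussianReal 0 1) with hP
  let ν : ℕ → ProbabilityMeasure ℝ := fun d =>
    ⟨(P d).map (S d), Measure.isProbabilityMeasure_map (hSm d).aemeasurable⟩
  let ν0 : ProbabilityMeasure ℝ := ⟨gaussianReal (-(s^2)/2) (s^2).toNNReal, inferInstance⟩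
  have hconv : Tendsto ν atTop (𝓝 ν0) := by
    rw [ProbabilityMeasure.tendsto_iff_tendsto_charFun]
    intro t
    have hl := charFun_lim V Vdot hV hVdot hVint p C β hp hC hβ hH1i hH1ii ℓ t
    have e0 : charFun (ν0 : Measure ℝ) t = Complex.exp ((-(t:ℂ)^2/2 - t * Complex.I/2) *
        ((ℓ^2 * I : ℝ) : ℂ)) := by
      change charFun (gaussianReal (-(s^2)/2) (s^2).toNNReal) t = _
      rw [charFun_gaussianReal, ← hs2]
      congr 1
      rw [Real.coe_toNNReal _ (by positivity)]
      push_cast; ring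
    rw [e0]
    refine hl.congr fun d => ?_
    rw [← pi_prod_integral]
    change _ = charFun ((P d).map (S d)) t
    have hSd := hSm d
    rw [charFun_apply_real, integral_map (by fun_prop) (Measurable.aestronglyMeasurable (by fun_prop))]
    congr 1
    ext w
    rw [← Complex.exp_sum]
    congr 1
    simp only [hS]
    push_cast
    rw [Finset.mul_sum, Finset.sum_mul]
  let f : BoundedContinuousFunction ℝ ℝ :=
    BoundedContinuousFunction.ofNormedAddCommGroup (fun w => min 1 (Real.exp w)) (by fun_prop) 1
      (fun w => by rw [Real.norm_of_nonneg (by positivity)]; exact min_le_left _ _)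
  have hfin := (ProbabilityMeasure.tendsto_iff_forall_integral_tendsto.1 hconv) f
  have hlim : ∫ w, f w ∂(ν0 : Measure ℝ) = 2 * stdGaussCDF (-s/2) :=
    integral_min_exp_gaussian s hs0
  rw [hlim] at hfin
  refine hfin.congr fun d => ?_
  change ∫ w, min 1 (Real.exp w) ∂((P d).map (S d)) = _
  rw [integral_map (hSm d).aemeasurable (Continuous.aestronglyMeasurable (by fun_prop))]
  congr 1
  ext w
  congr 1
  simp only [hS]
  rw [Real.exp_sum]
  refine Finset.prod_congr rfl fun i _ => ?_
  unfold piDen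
  have hZ := (Z_pos V hVint).ne'
  rw [div_div_div_cancel_right₀ hZ, ← Real.exp_sub]
  congr 1; ring
end
end

section
/- Let X, Y and U be real-valued random variables with U nonnegative and bounded by 1, let ε > 0, and let g : ℝ → ℝ be a bounded function such that |g(x) − g(y)| ≤ C_g |x − y| for all pairs (x,y) in (−∞, −ε]² ∪ [ε, +∞)². Then for all a > 0, E[U |g(X) − g(Y)|] ≤ C_g E[U |X − Y|] + osc(g) · { P(|X| ≤ ε) + a^{−1} E[U |X − Y|] + P(ε < |X| < ε + a) }, where osc(g) = sup g − inf g. -/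
open MeasureTheory ProbabilityTheory Filter Real
open scoped ENNReal NNReal Topology

noncomputable section

/-- Lemma 8(i). -/
theorem stmt_10 {Ω : Type*} [MeasurableSpace Ω] (P : Measure Ω) [IsProbabilityMeasure P]
    (X Y U : Ω → ℝ) (hX : Measurable X) (hY : Measurable Y) (hU : Measurable U)
    (hU01 : ∀ ω, 0 ≤ U ω ∧ U ω ≤ 1)
    (ε : ℝ) (hε : 0 < ε)
    (g : ℝ → ℝ) (hgm : Measurable g) (hgb : ∃ M, ∀ x, |g x| ≤ M)
    (Cg : ℝ)
    (hg : ∀ x y : ℝ, (x ≤ -ε ∧ y ≤ -ε) ∨ (ε ≤ x ∧ ε ≤ y) → |g x - g y| ≤ Cg * |x - y|)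
    (hXY : Integrable (fun ω => U ω * |X ω - Y ω|) P) :
    ∀ a : ℝ, 0 < a →
      ∫ ω, U ω * |g (X ω) - g (Y ω)| ∂P ≤
        Cg * ∫ ω, U ω * |X ω - Y ω| ∂P +
          ((⨆ x, g x) - ⨅ x, g x) *
            ((P {ω | |X ω| ≤ ε}).toReal + a⁻¹ * ∫ ω, U ω * |X ω - Y ω| ∂P +
              (P {ω | ε < |X ω| ∧ |X ω| < ε + a}).toReal) := by
  intro a ha
  obtain ⟨M, hM⟩ := hgb
  have hba : BddAbove (Set.range g) := ⟨M, by rintro _ ⟨x, rfl⟩; exact (abs_le.1 (hM x)).2⟩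
  have hbb : BddBelow (Set.range g) := ⟨-M, by rintro _ ⟨x, rfl⟩; exact (abs_le.1 (hM x)).1⟩
  set D : ℝ := (⨆ x, g x) - ⨅ x, g x with hD
  have hosc : ∀ x y, |g x - g y| ≤ D := by
    intro x y
    have h1 := le_ciSup hba x
    have h2 := le_ciSup hba y
    have h3 := ciInf_le hbb x
    have h4 := ciInf_le hbb y
    rw [abs_le]
    constructor <;> linarith
  have hD0 : 0 ≤ D := (abs_nonneg _).trans (hosc 0 0)
  have hC : 0 ≤ Cg := by
    have h := hg (ε + 1) ε (Or.inr ⟨by linarith, le_rfl⟩)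
    have h1 : |ε + 1 - ε| = 1 := by
      rw [add_sub_cancel_left, abs_one]
    rw [h1, mul_one] at h
    exact (abs_nonneg _).trans h
  set A : Set Ω := {ω | |X ω| ≤ ε} with hA
  set B : Set Ω := {ω | ε < |X ω| ∧ |X ω| < ε + a} with hB
  have hmX : Measurable (fun ω => |X ω|) := hX.abs
  have hAm : MeasurableSet A := measurableSet_le hmX measurable_const
  have hBm : MeasurableSet B :=
    (measurableSet_lt measurable_const hmX).inter (measurableSet_lt hmX measurable_const)
  have iA : Integrable (A.indicator (fun _ => (1 : ℝ))) P := (integrable_const 1).indicator hAm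
  have iB : Integrable (B.indicator (fun _ => (1 : ℝ))) P := (integrable_const 1).indicator hBm
  have eA : ∫ ω, A.indicator (fun _ => (1 : ℝ)) ω ∂P = (P A).toReal := by
    rw [integral_indicator hAm]; simp [Measure.real]
  have eB : ∫ ω, B.indicator (fun _ => (1 : ℝ)) ω ∂P = (P B).toReal := by
    rw [integral_indicator hBm]; simp [Measure.real]
  have i1 : Integrable (fun ω => Cg * (U ω * |X ω - Y ω|)) P := hXY.const_mul _
  have i2 : Integrable (fun ω => a⁻¹ * (U ω * |X ω - Y ω|)) P := hXY.const_mul _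
  have i3 : Integrable (fun ω => A.indicator (fun _ => (1 : ℝ)) ω
      + a⁻¹ * (U ω * |X ω - Y ω|)) P := iA.add i2
  have i4 : Integrable (fun ω => A.indicator (fun _ => (1 : ℝ)) ω
      + a⁻¹ * (U ω * |X ω - Y ω|) + B.indicator (fun _ => (1 : ℝ)) ω) P := i3.add iB
  have i5 : Integrable (fun ω => D * (A.indicator (fun _ => (1 : ℝ)) ω
      + a⁻¹ * (U ω * |X ω - Y ω|) + B.indicator (fun _ => (1 : ℝ)) ω)) P := i4.const_mul _
  have key : ∀ ω, U ω * |g (X ω) - g (Y ω)| ≤ Cg * (U ω * |X ω - Y ω|)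
      + D * (A.indicator (fun _ => (1 : ℝ)) ω
      + a⁻¹ * (U ω * |X ω - Y ω|) + B.indicator (fun _ => (1 : ℝ)) ω) := by
    intro ω
    obtain ⟨u0, u1⟩ := hU01 ω
    have t0 : 0 ≤ U ω * |X ω - Y ω| := mul_nonneg u0 (abs_nonneg _)
    have t1 : 0 ≤ Cg * (U ω * |X ω - Y ω|) := mul_nonneg hC t0
    have t2 : 0 ≤ a⁻¹ * (U ω * |X ω - Y ω|) := mul_nonneg (inv_nonneg.2 ha.le) t0
    have nA : 0 ≤ A.indicator (fun _ => (1 : ℝ)) ω :=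
      Set.indicator_nonneg (fun _ _ => zero_le_one) ω
    have nB : 0 ≤ B.indicator (fun _ => (1 : ℝ)) ω :=
      Set.indicator_nonneg (fun _ _ => zero_le_one) ω
    have ho := hosc (X ω) (Y ω)
    have big : ∀ S : ℝ, U ω ≤ S → U ω * |g (X ω) - g (Y ω)|
        ≤ Cg * (U ω * |X ω - Y ω|) + D * S := by
      intro S hS
      have h1 := mul_le_mul_of_nonneg_left ho u0
      have h2 := mul_le_mul_of_nonneg_left hS hD0
      linarith
    by_cases h1 : ω ∈ A
    · apply big
      rw [Set.indicator_of_mem h1]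
      linarith
    by_cases h2 : ω ∈ B
    · apply big
      rw [Set.indicator_of_mem h2]
      linarith
    have h1' : ε < |X ω| := not_le.1 h1
    have h2' : ε + a ≤ |X ω| := not_lt.1 fun h => h2 ⟨h1', h⟩
    by_cases h3 : (X ω ≤ -ε ∧ Y ω ≤ -ε) ∨ (ε ≤ X ω ∧ ε ≤ Y ω)
    · have h4 := mul_le_mul_of_nonneg_left (hg _ _ h3) u0
      have h5 := mul_nonneg hD0 (add_nonneg (add_nonneg nA t2) nB)
      nlinarith
    · have h4 : a ≤ |X ω - Y ω| := by
        push Not at h3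
        rcases le_abs.1 h2' with h | h
        · have := h3.2 (by linarith)
          exact le_trans (by linarith) (le_abs_self _)
        · have := h3.1 (by linarith)
          exact le_trans (by linarith) (neg_le_abs _)
      apply big
      have h5 : U ω ≤ a⁻¹ * (U ω * |X ω - Y ω|) := by
        rw [inv_mul_eq_div, le_div_iff₀ ha]
        exact mul_le_mul_of_nonneg_left h4 u0
      linarith
  calc ∫ ω, U ω * |g (X ω) - g (Y ω)| ∂P
      ≤ ∫ ω, (Cg * (U ω * |X ω - Y ω|) + D * (A.indicator (fun _ => (1 : ℝ)) ω
      + a⁻¹ * (U ω * |X ω - Y ω|) + B.indicator (fun _ => (1 : ℝ)) ω)) ∂P :=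
        integral_mono_of_nonneg
          (Eventually.of_forall fun ω => mul_nonneg (hU01 ω).1 (abs_nonneg _))
          (i1.add i5) (Eventually.of_forall key)
    _ = _ := by
      rw [integral_add i1 i5, integral_const_mul, integral_const_mul, integral_add i3 iB,
        integral_add iA i2, integral_const_mul, eA, eB]
end
end

section
/- Let X, Y and U be real-valued random variables with U nonnegative and bounded by 1, let ε > 0, and let g : ℝ → ℝ be a bounded function such that |g(x) − g(y)| ≤ C_g |x − y| for all pairs (x,y) in (−∞, −ε]² ∪ [ε, +∞)². Suppose moreover there exist μ ∈ ℝ, σ > 0 and C_X ≥ 0 such that sup_{x ∈ ℝ} |P(X ≤ x) − Φ((x − μ)/σ)| ≤ C_X, where Φ is the standard normal cumulative distribution function. Then E[U |g(X) − g(Y)|] ≤ C_g E[U |X − Y|] + 2 osc(g) · { C_X + √(2 E[U |X − Y|] (2πσ²)^{−1/2}) + ε (2πσ²)^{−1/2} }, where osc(g) = sup g − inf g. -/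
open MeasureTheory ProbabilityTheory Filter Real
open scoped ENNReal NNReal Topology

noncomputable section

theorem gauss_cdf_diff (a b : ℝ) (hab : a ≤ b) :
    stdGaussCDF b - stdGaussCDF a ≤ (b - a) * (Real.sqrt (2 * Real.pi))⁻¹ := by
  unfold stdGaussCDF
  have h1 : (gaussianReal 0 1 (Set.Iic b)).toReal - (gaussianReal 0 1 (Set.Iic a)).toReal
      = (gaussianReal 0 1 (Set.Ioc a b)).toReal := by
    have hset : Set.Ioc a b = Set.Iic b \ Set.Iic a := by
      ext x
      simp [and_comm]
    rw [hset]
    have := measureReal_sdiff (μ := gaussianReal 0 1) (Set.Iic_subset_Iic.2 hab)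
      (measurableSet_Iic (a := a))
    simp only [Measure.real] at this
    exact this.symm
  rw [h1, gaussianReal_apply 0 one_ne_zero]
  have hc : 0 ≤ (Real.sqrt (2 * Real.pi))⁻¹ := by positivity
  refine ENNReal.toReal_le_of_le_ofReal (mul_nonneg (by linarith) hc) ?_
  calc ∫⁻ x in Set.Ioc a b, gaussianPDF 0 1 x
      ≤ ∫⁻ x in Set.Ioc a b, ENNReal.ofReal (Real.sqrt (2 * Real.pi))⁻¹ := by
        refine lintegral_mono fun x => ?_
        refine ENNReal.ofReal_le_ofReal ?_
        simp only [gaussianPDFReal]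
        have : Real.exp (-(x - 0) ^ 2 / (2 * ((1 : ℝ≥0) : ℝ))) ≤ 1 := by
          rw [Real.exp_le_one_iff]
          simp only [NNReal.coe_one]
          nlinarith [sq_nonneg (x - 0)]
        simpa using mul_le_mul_of_nonneg_left this hc
    _ = ENNReal.ofReal ((b - a) * (Real.sqrt (2 * Real.pi))⁻¹) := by
        rw [setLIntegral_const, Real.volume_Ioc, mul_comm, ENNReal.ofReal_mul (by linarith)]

/-- Lemma 8(ii). -/
theorem stmt_11 {Ω : Type*} [MeasurableSpace Ω] (P : Measure Ω) [IsProbabilityMeasure P]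
    (X Y U : Ω → ℝ) (hX : Measurable X) (hY : Measurable Y) (hU : Measurable U)
    (hU01 : ∀ ω, 0 ≤ U ω ∧ U ω ≤ 1)
    (ε : ℝ) (hε : 0 < ε)
    (g : ℝ → ℝ) (hgm : Measurable g) (hgb : ∃ M, ∀ x, |g x| ≤ M)
    (Cg : ℝ)
    (hg : ∀ x y : ℝ, (x ≤ -ε ∧ y ≤ -ε) ∨ (ε ≤ x ∧ ε ≤ y) → |g x - g y| ≤ Cg * |x - y|)
    (hXY : Integrable (fun ω => U ω * |X ω - Y ω|) P)
    (μ σ CX : ℝ) (hσ : 0 < σ) (hCX : 0 ≤ CX)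
    (hgauss : ∀ x : ℝ, |(P {ω | X ω ≤ x}).toReal - stdGaussCDF ((x - μ) / σ)| ≤ CX) :
    ∫ ω, U ω * |g (X ω) - g (Y ω)| ∂P ≤
      Cg * ∫ ω, U ω * |X ω - Y ω| ∂P +
        2 * ((⨆ x, g x) - ⨅ x, g x) *
          (CX + Real.sqrt (2 * (∫ ω, U ω * |X ω - Y ω| ∂P) *
              (Real.sqrt (2 * Real.pi * σ ^ 2))⁻¹) +
            ε * (Real.sqrt (2 * Real.pi * σ ^ 2))⁻¹) := by
  obtain ⟨M, hM⟩ := hgb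
  set E := ∫ ω, U ω * |X ω - Y ω| ∂P with hE
  set O := (⨆ x, g x) - ⨅ x, g x with hO
  set a := (Real.sqrt (2 * Real.pi * σ ^ 2))⁻¹ with ha
  have ha0 : 0 < a := by positivity
  have hE0 : 0 ≤ E := integral_nonneg fun ω => mul_nonneg (hU01 ω).1 (abs_nonneg _)
  have hosc : ∀ x y, |g x - g y| ≤ O := by
    have hba : BddAbove (Set.range g) := ⟨M, by rintro _ ⟨x, rfl⟩; exact (abs_le.1 (hM x)).2⟩
    have hbb : BddBelow (Set.range g) := ⟨-M, by rintro _ ⟨x, rfl⟩; exact (abs_le.1 (hM x)).1⟩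
    intro x y
    have h1 := le_ciSup hba x
    have h2 := le_ciSup hba y
    have h3 := ciInf_le hbb x
    have h4 := ciInf_le hbb y
    rw [abs_le]; constructor <;> linarith
  have hO0 : 0 ≤ O := (abs_nonneg _).trans (hosc 0 0)
  have hCg : 0 ≤ Cg := by
    have h := (abs_nonneg _).trans (hg (ε + 1) ε (Or.inr ⟨by linarith, le_rfl⟩))
    simpa using h
  have key : ∀ δ > 0, ∫ ω, U ω * |g (X ω) - g (Y ω)| ∂P ≤
      Cg * E + O * (2 * CX + 2 * ε * a + 2 * δ * a + E / δ) := by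
    intro δ hδ
    set A : Set Ω := X ⁻¹' Set.Ioc (-(ε + δ)) (ε + δ) with hA
    have hAm : MeasurableSet A := hX measurableSet_Ioc
    have hPA : P.real A ≤ 2 * CX + 2 * ε * a + 2 * δ * a := by
      have h1 : P.real A = (P {ω | X ω ≤ ε + δ}).toReal - (P {ω | X ω ≤ -(ε + δ)}).toReal := by
        have hs : {ω | X ω ≤ -(ε + δ)} ⊆ {ω | X ω ≤ ε + δ} := by
          intro ω h
          simp only [Set.mem_ofPred_eq] at h ⊢
          linarith
        have h := measureReal_sdiff (μ := P) hs (hX measurableSet_Iic)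
        simp only [Measure.real] at h ⊢
        rw [← h]
        congr 2
        ext ω
        simp [hA, and_comm]
      have h2 := abs_le.1 (hgauss (ε + δ))
      have h3 := abs_le.1 (hgauss (-(ε + δ)))
      have h4 := gauss_cdf_diff ((-(ε + δ) - μ) / σ) ((ε + δ - μ) / σ)
        (by gcongr; linarith)
      have h5 : ((ε + δ - μ) / σ - (-(ε + δ) - μ) / σ) * (Real.sqrt (2 * Real.pi))⁻¹
          = 2 * ε * a + 2 * δ * a := by
        rw [ha, Real.sqrt_mul (x := 2 * Real.pi) (by positivity) (σ ^ 2), Real.sqrt_sq hσ.le]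
        field_simp
        ring
      rw [h5] at h4
      rw [h1]
      linarith [h2.1, h2.2, h3.1, h3.2]
    have hI : Integrable (A.indicator fun _ => O) P := (integrable_const O).indicator hAm
    have hint : ∫ ω, ((Cg + O / δ) * (U ω * |X ω - Y ω|) + A.indicator (fun _ => O) ω) ∂P
        = (Cg + O / δ) * E + P.real A * O := by
      rw [integral_add (hXY.const_mul _) hI, integral_const_mul, integral_indicator_const _ hAm,
        smul_eq_mul]
    have hle : ∫ ω, U ω * |g (X ω) - g (Y ω)| ∂P ≤
        ∫ ω, ((Cg + O / δ) * (U ω * |X ω - Y ω|) + A.indicator (fun _ => O) ω) ∂P := by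
      refine integral_mono_of_nonneg
        (Eventually.of_forall fun ω => mul_nonneg (hU01 ω).1 (abs_nonneg _))
        ((hXY.const_mul _).add hI) (Eventually.of_forall fun ω => ?_)
      obtain ⟨hu0, hu1⟩ := hU01 ω
      have hoc := hosc (X ω) (Y ω)
      have hd := abs_nonneg (X ω - Y ω)
      have hg0 := abs_nonneg (g (X ω) - g (Y ω))
      have hOδ : 0 ≤ O / δ := by positivity
      have t1 : 0 ≤ Cg * (U ω * |X ω - Y ω|) := by positivity
      have t2 : 0 ≤ O / δ * (U ω * |X ω - Y ω|) := by positivity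
      simp only [add_mul]
      by_cases hωA : ω ∈ A
      · rw [Set.indicator_of_mem hωA]
        have : U ω * |g (X ω) - g (Y ω)| ≤ 1 * O := mul_le_mul hu1 hoc hg0 zero_le_one
        linarith
      · rw [Set.indicator_of_notMem hωA]
        by_cases hs : (X ω ≤ -ε ∧ Y ω ≤ -ε) ∨ (ε ≤ X ω ∧ ε ≤ Y ω)
        · have := mul_le_mul_of_nonneg_left (hg _ _ hs) hu0
          nlinarith
        · have hδd : δ ≤ |X ω - Y ω| := by
            simp only [hA, Set.mem_preimage, Set.mem_Ioc, not_and_or, not_lt, not_le] at hωA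
            push Not at hs
            rcases hωA with h | h
            · have := hs.1 (by linarith)
              exact le_abs.2 (Or.inr (by linarith))
            · have := hs.2 (by linarith)
              exact le_abs.2 (Or.inl (by linarith))
          have h1 : O ≤ O / δ * |X ω - Y ω| := by
            calc O = O / δ * δ := by field_simp
              _ ≤ _ := mul_le_mul_of_nonneg_left hδd hOδ
          have := mul_le_mul_of_nonneg_left (hoc.trans h1) hu0
          nlinarith
    rw [hint] at hle
    have h6 := mul_le_mul_of_nonneg_right hPA hO0
    have h7 : O / δ * E = O * (E / δ) := by ring
    nlinarith
  rcases hE0.eq_or_lt with h0 | hpos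
  · rw [← h0] at key ⊢
    simp only [mul_zero, zero_mul, Real.sqrt_zero, zero_div, add_zero] at key ⊢
    refine le_of_forall_pos_le_add fun η hη => ?_
    have h := key (η / (2 * a * (O + 1))) (by positivity)
    have h8 : O * (2 * (η / (2 * a * (O + 1))) * a) ≤ η := by
      have : O * (2 * (η / (2 * a * (O + 1))) * a) = η * (O / (O + 1)) := by
        field_simp
      rw [this]
      have : O / (O + 1) ≤ 1 := by rw [div_le_one (by linarith)]; linarith
      nlinarith
    nlinarith
  · set s := Real.sqrt (2 * E * a) with hs
    have hs0 : 0 < s := Real.sqrt_pos.2 (by positivity)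
    have hss : s ^ 2 = 2 * E * a := Real.sq_sqrt (by positivity)
    have h := key (s / (2 * a)) (by positivity)
    have e1 : 2 * (s / (2 * a)) * a = s := by field_simp
    have e2 : E / (s / (2 * a)) = s := by
      field_simp
      linarith
    rw [e1, e2] at h
    linarith
end
end
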